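/- arXiv:1707.05218 — 2 statements merged into one kernel-verified Lean document; each statement's English description precedes it below -/
import Mathlib

section
/- Let a be a real number such that 1/2 − 2a is not a nonpositive integer and neither 1/3 − 2a, 2/3 − 2a, nor 1 − 6a is a nonpositive integer. Then ₂F₁(a, a+1/2; 1/2−2a | −1/3) = (6^{−2a}/2) · { Γ(1/3−2a)/Γ(1/3) + Γ(2/3−2a)/Γ(2/3) } · Γ(1−4a)/Γ(1−6a). -/
open Polynomial Real

open Filter Topology in
theorem Real.Gamma_mul_Gamma_add_third_mul_Gamma_add_two_thirds (s : ℝ) :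
    Gamma s * Gamma (s + 1 / 3) * Gamma (s + 2 / 3) =
      Gamma (3 * s) * (1 / 3) ^ (3 * s) * (3 * (Gamma (1 / 3) * Gamma (2 / 3))) := by
  set c : ℕ → ℝ := fun n => n * (n.factorial : ℝ) ^ 3 * 27 ^ (n + 1) / (3 * n + 2).factorial with hc
  have hprod (s : ℝ) (n : ℕ) : ∏ j ∈ Finset.range (3 * n + 2 + 1), (3 * s + j) =
      27 ^ (n + 1) * ((∏ j ∈ Finset.range (n + 1), (s + j)) *
        (∏ j ∈ Finset.range (n + 1), (s + 1 / 3 + j)) *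
        ∏ j ∈ Finset.range (n + 1), (s + 2 / 3 + j)) := by
    rw [show 3 * n + 2 + 1 = 3 * (n + 1) by ring]
    induction n + 1 with
    | zero => simp
    | succ n ih =>
      rw [show 3 * (n + 1) = 3 * n + 1 + 1 + 1 by ring]
      simp only [Finset.prod_range_succ, ih]
      push_cast
      ring
  have hseq (s : ℝ) : ∀ᶠ n in atTop,
      GammaSeq s n * GammaSeq (s + 1 / 3) n * GammaSeq (s + 2 / 3) n =
        GammaSeq (3 * s) (3 * n + 2) * ((n : ℝ) / (3 * n + 2)) ^ (3 * s) * c n := by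
    filter_upwards [eventually_gt_atTop 0] with n hn
    have hn' : (0 : ℝ) < n := by exact_mod_cast hn
    have hpow : (n : ℝ) ^ s * (n : ℝ) ^ (s + 1 / 3) * (n : ℝ) ^ (s + 2 / 3) =
        (n : ℝ) ^ (3 * s) * n := by
      rw [← rpow_add hn', ← rpow_add hn', ← rpow_add_one hn'.ne']
      ring_nf
    have hpos : 0 < (3 * (n : ℝ) + 2) ^ (3 * s) := by positivity
    have hfac : ((3 * n + 2).factorial : ℝ) ≠ 0 := by positivity
    simp only [GammaSeq, hprod, hc]
    rw [div_rpow hn'.le (by positivity)]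
    push_cast
    calc _ = ((n : ℝ) ^ s * (n : ℝ) ^ (s + 1 / 3) * (n : ℝ) ^ (s + 2 / 3)) * n.factorial ^ 3 /
            ((∏ j ∈ Finset.range (n + 1), (s + j)) *
            (∏ j ∈ Finset.range (n + 1), (s + 1 / 3 + j)) *
            ∏ j ∈ Finset.range (n + 1), (s + 2 / 3 + j)) := by
          rw [div_mul_div_comm, div_mul_div_comm]; ring
      _ = _ := by
          rw [hpow]
          field_simp
  have hsub : Tendsto (fun n : ℕ => 3 * n + 2) atTop atTop :=
    tendsto_atTop_mono (fun n => show n ≤ 3 * n + 2 by lia) tendsto_id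
  have hratio : Tendsto (fun n : ℕ => (n : ℝ) / (3 * n + 2)) atTop (𝓝 (1 / 3)) := by
    simpa [add_comm] using tendsto_add_mul_div_add_mul_atTop_nhds (0 : ℝ) 2 1 (d := 3) (by norm_num)
  have hratio' (s : ℝ) : Tendsto (fun n : ℕ => ((n : ℝ) / (3 * n + 2)) ^ s) atTop
      (𝓝 ((1 / 3) ^ s)) := hratio.rpow_const (by norm_num)
  have hlim (s : ℝ) := ((GammaSeq_tendsto_Gamma s).mul
    (GammaSeq_tendsto_Gamma (s + 1 / 3))).mul (GammaSeq_tendsto_Gamma (s + 2 / 3))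
  have hlim' (s : ℝ) := ((GammaSeq_tendsto_Gamma (3 * s)).comp hsub).mul (hratio' (3 * s))
  have hone : Gamma (3 * (1 / 3)) * (1 / 3) ^ (3 * (1 / 3) : ℝ) = 1 / 3 := by norm_num
  have hclim : Tendsto c atTop (𝓝 (3 * (Gamma (1 / 3) * Gamma (2 / 3)))) := by
    have h1 := hlim' (1 / 3)
    rw [hone] at h1
    have h2 := ((hlim (1 / 3)).congr' (hseq _)).div h1 (by norm_num)
    have hv : Gamma (1 / 3) * Gamma (1 / 3 + 1 / 3) * Gamma (1 / 3 + 2 / 3) / (1 / 3) =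
        3 * (Gamma (1 / 3) * Gamma (2 / 3)) := by
      norm_num [Gamma_one]; ring
    rw [hv] at h2
    refine h2.congr' ?_
    filter_upwards [h1.eventually_ne (by norm_num : (1 / 3 : ℝ) ≠ 0)] with n hn
    exact mul_div_cancel_left₀ _ hn
  exact tendsto_nhds_unique ((hlim s).congr' (hseq s)) ((hlim' s).mul hclim)

open MeasureTheory Set in
theorem integral_pow_mul_one_sub_pow_rpow (p j : ℕ) (hp : 0 < p) {m : ℝ} (hm : 0 < m) :
    ∫ t in (0 : ℝ)..1, t ^ j * (1 - t ^ p) ^ (m - 1) =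
      1 / p * (Gamma ((j + 1) / p) * Gamma m / Gamma ((j + 1) / p + m)) := by
  have hp' : (0 : ℝ) < p := by exact_mod_cast hp
  set u : ℝ := (j + 1) / p with hu
  have hu0 : 0 < u := by positivity
  have hbeta := ProbabilityTheory.beta_eq_betaIntegralReal u m hu0 hm
  have hreal : Complex.betaIntegral u m =
      ((∫ x in (0 : ℝ)..1, x ^ (u - 1) * (1 - x) ^ (m - 1) : ℝ) : ℂ) := by
    rw [Complex.betaIntegral, ← intervalIntegral.integral_ofReal]
    refine intervalIntegral.integral_congr fun x hx => ?_
    rw [uIcc_of_le zero_le_one] at hx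
    rw [Complex.ofReal_mul, Complex.ofReal_cpow hx.1, Complex.ofReal_cpow (by linarith [hx.2])]
    push_cast
    rfl
  rw [hreal, Complex.ofReal_re, ProbabilityTheory.beta] at hbeta
  rw [hbeta, intervalIntegral.integral_of_le zero_le_one, intervalIntegral.integral_of_le zero_le_one,
    integral_Ioc_eq_integral_Ioo, integral_Ioc_eq_integral_Ioo]
  have himage : (fun t : ℝ => t ^ p) '' Ioo 0 1 = Ioo 0 1 := by
    ext y
    constructor
    · rintro ⟨t, ht, rfl⟩
      exact ⟨pow_pos ht.1 _, pow_lt_one₀ ht.1.le ht.2 hp.ne'⟩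
    · intro hy
      exact ⟨y ^ (1 / (p : ℝ)), ⟨rpow_pos_of_pos hy.1 _, rpow_lt_one hy.1.le hy.2 (by positivity)⟩,
        by simp [← rpow_mul_natCast hy.1.le, hp.ne']⟩
  have hinj : InjOn (fun t : ℝ => t ^ p) (Ioo 0 1) := fun x hx y hy h =>
    (pow_left_inj₀ hx.1.le hy.1.le hp.ne').1 h
  have key := integral_image_eq_integral_abs_deriv_smul (s := Ioo (0 : ℝ) 1) measurableSet_Ioo
    (fun x _ => (hasDerivAt_pow p x).hasDerivWithinAt) hinj
    (fun x => x ^ (u - 1) * (1 - x) ^ (m - 1))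
  rw [himage] at key
  rw [key, ← integral_const_mul]
  refine setIntegral_congr_fun measurableSet_Ioo fun t ht => ?_
  have ht0 : 0 < t := ht.1
  simp only [smul_eq_mul]
  rw [abs_of_nonneg (by positivity)]
  have : t ^ j = t ^ (p - 1) * (t ^ p) ^ (u - 1) := by
    rw [← rpow_natCast t p, ← rpow_mul ht0.le, ← rpow_natCast t (p - 1), ← rpow_add ht0,
      ← rpow_natCast t j]
    congr 1
    rw [Nat.cast_sub hp, hu]
    field_simp
    push_cast
    ring
  rw [this]
  field_simp
theorem integral_radial_sub {G : ℂ → ℂ} (hGc : ContinuousOn G (Metric.closedBall 0 1))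
    (hGd : DifferentiableOn ℂ G (Metric.ball 0 1)) {γ : ℝ → ℂ} {v : ℂ} {a b : ℝ} (hab : a ≤ b)
    (hγ : ∀ s, HasDerivAt γ v s) (hball : ∀ s ∈ Set.Ioo a b, γ s ∈ Metric.ball (0 : ℂ) 1)
    (hclosed : ∀ s ∈ Set.Icc a b, γ s ∈ Metric.closedBall (0 : ℂ) 1) :
    ∫ s in a..b, G (γ s) * v =
      (∫ t in (0 : ℝ)..1, G (t * γ b) * γ b) - ∫ t in (0 : ℝ)..1, G (t * γ a) * γ a := by
  obtain ⟨Q, hQ⟩ := hGd.isExactOn_ball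
  set P : ℂ → ℂ := fun w => ∫ t in (0 : ℝ)..1, G (t * w) * w with hP
  have hscale {w : ℂ} (hw : w ∈ Metric.closedBall (0 : ℂ) 1) {t : ℝ} (ht : t ∈ Set.Icc (0 : ℝ) 1) :
      (t : ℂ) * w ∈ Metric.closedBall (0 : ℂ) 1 := by
    rw [mem_closedBall_zero_iff] at hw ⊢
    rw [norm_mul, Complex.norm_of_nonneg ht.1]
    exact mul_le_one₀ ht.2 (norm_nonneg _) hw
  have hrad {w : ℂ} (hw : w ∈ Metric.closedBall (0 : ℂ) 1) :
      ContinuousOn (fun t : ℝ => G (t * w) * w) (Set.Icc 0 1) := by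
    refine ContinuousOn.mul (hGc.comp (by fun_prop) fun t ht => hscale hw ht) continuousOn_const
  have hPQ {w : ℂ} (hw : w ∈ Metric.ball (0 : ℂ) 1) : P w = Q w - Q 0 := by
    have h := intervalIntegral.integral_eq_sub_of_hasDerivAt
      (f := fun t : ℝ => Q (t * w)) (f' := fun t : ℝ => G (t * w) * w) (a := 0) (b := 1) ?_ ?_
    · simpa [hP] using h
    · intro t ht
      rw [Set.uIcc_of_le zero_le_one] at ht
      have hmem : (t : ℂ) * w ∈ Metric.ball (0 : ℂ) 1 := by
        rw [mem_ball_zero_iff] at hw ⊢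
        rw [norm_mul, Complex.norm_of_nonneg ht.1]
        exact lt_of_le_of_lt (mul_le_of_le_one_left (norm_nonneg _) ht.2) hw
      have hlin : HasDerivAt (fun t : ℝ => (t : ℂ) * w) w t := by
        simpa using (Complex.ofRealCLM.hasDerivAt (x := t)).mul_const w
      exact (hQ _ hmem).comp t hlin
    · refine ContinuousOn.intervalIntegrable ?_
      rw [Set.uIcc_of_le zero_le_one]
      exact hrad (Metric.ball_subset_closedBall hw)
  have hPd {w : ℂ} (hw : w ∈ Metric.ball (0 : ℂ) 1) : HasDerivAt P (G w) w := by
    refine ((hQ w hw).sub_const (Q 0)).congr_of_eventuallyEq ?_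
    filter_upwards [Metric.isOpen_ball.mem_nhds hw] with z hz using hPQ hz
  obtain ⟨M, hM⟩ := (isCompact_closedBall (0 : ℂ) 1).exists_bound_of_continuousOn hGc
  have hPc : ContinuousOn P (Metric.closedBall 0 1) := by
    intro w hw
    refine intervalIntegral.continuousWithinAt_of_dominated_interval (bound := fun _ => M)
      ?_ ?_ (by simp) ?_
    · filter_upwards [self_mem_nhdsWithin] with z hz
      rw [Set.uIoc_of_le zero_le_one]
      exact ((hrad hz).mono Set.Ioc_subset_Icc_self).aestronglyMeasurable measurableSet_Ioc
    · filter_upwards [self_mem_nhdsWithin] with z hz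
      refine .of_forall fun t ht => ?_
      rw [Set.uIoc_of_le zero_le_one] at ht
      rw [norm_mul]
      have h1 := hM _ (hscale hz (Set.Ioc_subset_Icc_self ht))
      rw [mem_closedBall_zero_iff] at hz
      nlinarith [norm_nonneg (G (t * z)), norm_nonneg z]
    · refine .of_forall fun t ht => ?_
      rw [Set.uIoc_of_le zero_le_one] at ht
      refine ContinuousWithinAt.mul ?_ continuousWithinAt_id
      exact (hGc _ (hscale hw (Set.Ioc_subset_Icc_self ht))).comp
        (f := fun z : ℂ => (t : ℂ) * z) (by fun_prop)
        fun z hz => hscale hz (Set.Ioc_subset_Icc_self ht)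
  have hγc : Continuous γ := continuous_iff_continuousAt.2 fun s => (hγ s).continuousAt
  refine intervalIntegral.integral_eq_sub_of_hasDerivAt_of_le hab
    (hPc.comp hγc.continuousOn hclosed) (fun s hs => (hPd (hball s hs)).comp s (hγ s)) ?_
  refine ContinuousOn.intervalIntegrable ?_
  rw [Set.uIcc_of_le hab]
  exact (hGc.comp hγc.continuousOn hclosed).mul continuousOn_const

theorem Complex.ofReal_mul_cpow_ofReal {r : ℝ} (hr : 0 ≤ r) {z : ℂ} (hz : z ≠ 0) {y : ℝ}
    (hy : y ≠ 0) : ((r : ℂ) * z) ^ (y : ℂ) = ((r ^ y : ℝ) : ℂ) * z ^ (y : ℂ) := by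
  rw [Complex.ofReal_cpow hr]
  rcases hr.eq_or_lt with rfl | hr
  · simp [hy]
  · have hr' : (r : ℂ) ≠ 0 := by exact_mod_cast hr.ne'
    rw [Complex.cpow_def_of_ne_zero (mul_ne_zero hr' hz), Complex.cpow_def_of_ne_zero hr',
      Complex.cpow_def_of_ne_zero hz, Complex.log_ofReal_mul hr hz, Complex.ofReal_log hr.le,
      add_mul, Complex.exp_add]

theorem integral_one_sub_sq_rpow_mul_cpow {m : ℝ} (hm : 1 < m) :
    ∫ s in (-1 : ℝ)..1, (((1 - s ^ 2) ^ (m - 1) : ℝ) : ℂ) *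
        (1 - s * (Complex.I / (√3 : ℝ))) ^ (m : ℂ) =
      (((8 / 9) ^ m / 2 * (Gamma (1 / 3) * Gamma m / Gamma (1 / 3 + m) +
        Gamma (2 / 3) * Gamma m / Gamma (2 / 3 + m)) : ℝ) : ℂ) := by
  have hm0 : 0 < m - 1 := by linarith
  have h3 : ((√3 : ℝ) : ℂ) ^ 2 = 3 := by
    rw [← Complex.ofReal_pow, Real.sq_sqrt (by norm_num)]; norm_num
  have h3' : ((√3 : ℝ) : ℂ) ≠ 0 := by
    simp
  set G : ℂ → ℂ := fun w => (1 - w ^ 3) ^ ((m - 1 : ℝ) : ℂ) * (1 - w) with hG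
  have hre {w : ℂ} (hw : w ∈ Metric.closedBall (0 : ℂ) 1) : 0 ≤ (1 - w ^ 3).re := by
    rw [mem_closedBall_zero_iff] at hw
    have h1 := Complex.re_le_norm (w ^ 3)
    rw [norm_pow] at h1
    have h2 := pow_le_one₀ (n := 3) (norm_nonneg w) hw
    simp only [Complex.sub_re, Complex.one_re]
    linarith
  have hre' {w : ℂ} (hw : w ∈ Metric.ball (0 : ℂ) 1) : 0 < (1 - w ^ 3).re := by
    rw [mem_ball_zero_iff] at hw
    have h1 := Complex.re_le_norm (w ^ 3)
    rw [norm_pow] at h1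
    have h2 := pow_lt_one₀ (n := 3) (norm_nonneg w) hw (by norm_num)
    simp only [Complex.sub_re, Complex.one_re]
    linarith
  have hGc : ContinuousOn G (Metric.closedBall 0 1) := by
    intro w hw
    refine ContinuousAt.continuousWithinAt (ContinuousAt.mul ?_ (by fun_prop))
    exact (Complex.continuousAt_cpow_const_of_re_pos (Or.inl (hre hw)) (by simpa using hm0)).comp
      (f := fun w : ℂ => 1 - w ^ 3) (by fun_prop)
  have hGd : DifferentiableOn ℂ G (Metric.ball 0 1) := by
    intro w hw
    refine DifferentiableAt.differentiableWithinAt (DifferentiableAt.mul ?_ (by fun_prop))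
    exact DifferentiableAt.cpow_const (by fun_prop) (Or.inl (hre' hw))
  set v : ℂ := (√3 : ℝ) / 2 * Complex.I with hv
  set γ : ℝ → ℂ := fun s => -1 / 2 + s * v with hγ
  have hv2 : v ^ 2 = -3 / 4 := by
    rw [hv, mul_pow, div_pow, h3, Complex.I_sq]; norm_num
  have hγd (s : ℝ) : HasDerivAt γ v s := by
    simpa [hγ] using ((Complex.ofRealCLM.hasDerivAt (x := s)).mul_const v).const_add (-1 / 2)
  have hnorm (s : ℝ) : ‖γ s‖ ^ 2 = 1 / 4 + 3 / 4 * s ^ 2 := by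
    rw [Complex.sq_norm, Complex.normSq_apply]
    simp [hγ, hv]
    ring_nf
    norm_num
    ring
  have hmain := integral_radial_sub hGc hGd (a := -1) (b := 1) (by norm_num) hγd
    (fun s hs => by
      rw [mem_ball_zero_iff, ← sq_lt_one_iff₀ (norm_nonneg _), hnorm]
      nlinarith [hs.1, hs.2])
    (fun s hs => by
      rw [mem_closedBall_zero_iff, ← sq_le_one_iff₀ (norm_nonneg _), hnorm]
      nlinarith [hs.1, hs.2])
  have hz (s : ℝ) : 1 - s * (Complex.I / (√3 : ℝ)) ≠ 0 := by
    intro h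
    have := congrArg Complex.re h
    simp at this
  have hx : Complex.I / (√3 : ℝ) = 2 / 3 * v := by
    rw [hv]; field_simp; rw [h3]
  have hside : ∀ s ∈ Set.uIcc (-1 : ℝ) 1, G (γ s) * v = ((9 / 8) ^ (m - 1) : ℝ) * (3 / 2) * v *
      ((((1 - s ^ 2) ^ (m - 1) : ℝ) : ℂ) * (1 - s * (Complex.I / (√3 : ℝ))) ^ (m : ℂ)) := by
    intro s hs
    rw [Set.uIcc_of_le (by norm_num)] at hs
    have hs2 : 0 ≤ 1 - s ^ 2 := by nlinarith [hs.1, hs.2]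
    have hcube : 1 - γ s ^ 3 =
        ((9 / 8 * (1 - s ^ 2) : ℝ) : ℂ) * (1 - s * (Complex.I / (√3 : ℝ))) := by
      rw [hx]
      simp only [hγ]
      push_cast
      linear_combination (3 / 2 * s ^ 2 - s ^ 3 * v) * hv2
    have hlin : 1 - γ s = 3 / 2 * (1 - s * (Complex.I / (√3 : ℝ))) := by
      rw [hx]; simp only [hγ]; ring
    have hpow : (1 - s * (Complex.I / (√3 : ℝ))) ^ (m : ℂ) =
        (1 - s * (Complex.I / (√3 : ℝ))) ^ ((m - 1 : ℝ) : ℂ) *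
          (1 - s * (Complex.I / (√3 : ℝ))) := by
      nth_rw 3 [← Complex.cpow_one (1 - s * (Complex.I / (√3 : ℝ)))]
      rw [← Complex.cpow_add _ _ (hz s)]
      push_cast
      ring_nf
    simp only [hG]
    rw [hcube, Complex.ofReal_mul_cpow_ofReal (by positivity) (hz s) hm0.ne',
      Real.mul_rpow (by norm_num) hs2, hlin, hpow]
    push_cast
    ring
  have hradial (z : ℂ) (hz3 : z ^ 3 = 1) : ∫ t in (0 : ℝ)..1, G (t * z) * z =
      z * ((1 / 3 * (Gamma (1 / 3) * Gamma m / Gamma (1 / 3 + m)) : ℝ) : ℂ) -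
        z ^ 2 * ((1 / 3 * (Gamma (2 / 3) * Gamma m / Gamma (2 / 3 + m)) : ℝ) : ℂ) := by
    have hb0 := integral_pow_mul_one_sub_pow_rpow 3 0 (by norm_num) (m := m) (by linarith)
    have hb1 := integral_pow_mul_one_sub_pow_rpow 3 1 (by norm_num) (m := m) (by linarith)
    have hint (j : ℕ) : IntervalIntegrable
        (fun t : ℝ => ((t ^ j * (1 - t ^ 3) ^ (m - 1) : ℝ) : ℂ)) MeasureTheory.volume 0 1 := by
      refine Continuous.intervalIntegrable (Complex.continuous_ofReal.comp ?_) _ _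
      exact (continuous_pow j).mul ((by fun_prop : Continuous fun t : ℝ => 1 - t ^ 3).rpow_const
        fun _ => Or.inr hm0.le)
    have hcongr : ∀ t ∈ Set.uIcc (0 : ℝ) 1, G (t * z) * z =
        z * ((t ^ 0 * (1 - t ^ 3) ^ (m - 1) : ℝ) : ℂ) -
          z ^ 2 * ((t ^ 1 * (1 - t ^ 3) ^ (m - 1) : ℝ) : ℂ) := by
      intro t ht
      rw [Set.uIcc_of_le zero_le_one] at ht
      have ht3 : 0 ≤ 1 - t ^ 3 := sub_nonneg.2 (pow_le_one₀ ht.1 ht.2)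
      simp only [hG]
      rw [mul_pow, hz3, Complex.ofReal_mul, Complex.ofReal_mul, Complex.ofReal_cpow ht3]
      push_cast
      ring_nf
    rw [intervalIntegral.integral_congr hcongr,
      intervalIntegral.integral_sub ((hint 0).const_mul _) ((hint 1).const_mul _),
      intervalIntegral.integral_const_mul, intervalIntegral.integral_const_mul,
      intervalIntegral.integral_ofReal, intervalIntegral.integral_ofReal, hb0, hb1]
    norm_num
  have hγ1 : γ 1 ^ 3 = 1 := by
    simp only [hγ]; push_cast; linear_combination (v - 3 / 2) * hv2
  have hγ2 : γ (-1) ^ 3 = 1 := by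
    simp only [hγ]; push_cast; linear_combination (-v - 3 / 2) * hv2
  rw [intervalIntegral.integral_congr hside, intervalIntegral.integral_const_mul, hradial _ hγ1,
    hradial _ hγ2] at hmain
  have hv0 : v ≠ 0 := fun h => by norm_num [h] at hv2
  have hc : (((9 / 8) ^ (m - 1) : ℝ) : ℂ) * (((8 / 9) ^ m : ℝ) : ℂ) = 8 / 9 := by
    rw [← Complex.ofReal_mul, Real.rpow_sub_one (by norm_num), div_mul_eq_mul_div,
      ← Real.mul_rpow (by norm_num) (by norm_num)]
    norm_num
  have hc0 : (((9 / 8) ^ (m - 1) : ℝ) : ℂ) ≠ 0 := 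
    Complex.ofReal_ne_zero.2 (by positivity)
  refine mul_left_cancel₀ (mul_ne_zero (mul_ne_zero hc0 (by norm_num : (3 / 2 : ℂ) ≠ 0)) hv0)
    (hmain.trans ?_)
  generalize Gamma (1 / 3) * Gamma m / Gamma (1 / 3 + m) = B₁
  generalize Gamma (2 / 3) * Gamma m / Gamma (2 / 3 + m) = B₂
  simp only [hγ]
  push_cast at hc ⊢
  linear_combination (-(3 / 4) * v * (B₁ + B₂)) * hc

/-- The `k`-th term of `₂F₁(a, a + 1/2; 1/2 - 2a | -1/3)` divided by `Γ(1/2 - 2a)`; it is an entire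
function of `a`. -/
noncomputable def regularizedTerm (a : ℂ) (k : ℕ) : ℂ :=
  (ascPochhammer ℂ k).eval a * (ascPochhammer ℂ k).eval (a + 1 / 2) / (k.factorial : ℂ) *
    (-1 / 3) ^ k * (Complex.Gamma (1 / 2 - 2 * a + k))⁻¹

theorem hasSum_ascPochhammer_one_sub_cpow (b : ℂ) {x : ℂ} (hx : ‖x‖ < 1) :
    HasSum (fun n : ℕ => (ascPochhammer ℂ n).eval b / (n.factorial : ℂ) * x ^ n)
      ((1 - x) ^ (-b)) := by
  have h := (Complex.one_div_one_sub_cpow_hasFPowerSeriesOnBall_zero b).hasSum (y := x)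
    (by rwa [Metric.mem_eball, edist_zero_right, ← ofReal_norm, ENNReal.ofReal_lt_one])
  rw [zero_add, one_div, ← Complex.cpow_neg] at h
  refine h.congr_fun fun n => ?_
  have hf := Ring.factorial_nsmul_multichoose_eq_ascPochhammer b n
  rw [ascPochhammer_smeval_eq_eval, nsmul_eq_mul] at hf
  have hn : (n.factorial : ℂ) ≠ 0 := by exact_mod_cast n.factorial_ne_zero
  simp [FormalMultilinearSeries.ofScalars, ← Ring.multichoose_eq, ← hf, hn]

theorem eval_ascPochhammer_two_mul_double (a : ℂ) (k : ℕ) :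
    (ascPochhammer ℂ (2 * k)).eval (2 * a) =
      4 ^ k * ((ascPochhammer ℂ k).eval a * (ascPochhammer ℂ k).eval (a + 1 / 2)) := by
  induction k with
  | zero => simp
  | succ k ih =>
    rw [show 2 * (k + 1) = 2 * k + 1 + 1 by ring]
    simp only [ascPochhammer_succ_eval, ih]
    push_cast
    ring

theorem factorial_two_mul_mul_sqrt_pi (k : ℕ) :
    ((2 * k).factorial : ℝ) * √π = 4 ^ k * (k.factorial : ℝ) * Gamma (k + 1 / 2) := by
  induction k with
  | zero => simp [← Real.Gamma_one_half_eq]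
  | succ k ih =>
    rw [show 2 * (k + 1) = 2 * k + 1 + 1 by ring, Nat.factorial_succ, Nat.factorial_succ,
      Nat.factorial_succ]
    push_cast
    rw [show (k : ℝ) + 1 + 1 / 2 = (k + 1 / 2) + 1 by ring,
      Real.Gamma_add_one (by positivity : (k : ℝ) + 1 / 2 ≠ 0)]
    linear_combination (2 * (k : ℝ) + 1 + 1) * (2 * k + 1) * ih

theorem integral_neg_one_one_pow_mul_one_sub_sq_rpow (j : ℕ) {m : ℝ} (hm : 1 < m) :
    ∫ s in (-1 : ℝ)..1, s ^ j * (1 - s ^ 2) ^ (m - 1) =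
      (1 + (-1) ^ j) / 2 * (Gamma ((j + 1) / 2) * Gamma m / Gamma ((j + 1) / 2 + m)) := by
  have hcont : Continuous fun s : ℝ => s ^ j * (1 - s ^ 2) ^ (m - 1) :=
    (continuous_pow j).mul ((by fun_prop : Continuous fun t : ℝ => 1 - t ^ 2).rpow_const
      fun _ => Or.inr (by linarith))
  have hhalf := integral_pow_mul_one_sub_pow_rpow 2 j (by norm_num) (m := m) (by linarith)
  have hneg : ∫ s in (-1 : ℝ)..0, s ^ j * (1 - s ^ 2) ^ (m - 1) =
      (-1) ^ j * ∫ s in (0 : ℝ)..1, s ^ j * (1 - s ^ 2) ^ (m - 1) := by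
    have h := intervalIntegral.integral_comp_neg (a := 0) (b := 1)
      fun s : ℝ => s ^ j * (1 - s ^ 2) ^ (m - 1)
    rw [neg_zero] at h
    rw [← h, ← intervalIntegral.integral_const_mul]
    refine intervalIntegral.integral_congr fun s _ => ?_
    rw [neg_pow, neg_sq, mul_assoc]
  rw [← intervalIntegral.integral_add_adjacent_intervals (hcont.intervalIntegrable (-1) 0)
    (hcont.intervalIntegrable 0 1), hneg, hhalf]
  push_cast
  ring

theorem hasSum_regularizedTerm_of_lt {a : ℝ} (ha : a < -1 / 2) :
    HasSum (regularizedTerm a)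
      (((8 / 9) ^ (-2 * a) / (2 * √π) * (Gamma (1 / 3) / Gamma (1 / 3 - 2 * a) +
        Gamma (2 / 3) / Gamma (2 / 3 - 2 * a)) : ℝ) : ℂ) := by
  obtain ⟨m, hma⟩ : ∃ m : ℝ, m = -2 * a := ⟨_, rfl⟩
  have hm : 1 < m := by linarith
  have hx0 : ‖Complex.I / ((√3 : ℝ) : ℂ)‖ < 1 := by
    rw [norm_div, Complex.norm_I, Complex.norm_of_nonneg (by positivity),
      div_lt_one (by positivity), Real.lt_sqrt (by norm_num)]
    norm_num
  set x₀ : ℂ := Complex.I / ((√3 : ℝ) : ℂ) with hx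
  have hx2 : x₀ ^ 2 = -1 / 3 := by
    rw [hx, div_pow, Complex.I_sq, ← Complex.ofReal_pow, Real.sq_sqrt (by norm_num)]; norm_num
  set c : ℕ → ℂ := fun j => (ascPochhammer ℂ j).eval (2 * a : ℂ) / (j.factorial : ℂ) with hc
  have hsum : Summable fun j => ‖c j * x₀ ^ j‖ :=
    (hasSum_ascPochhammer_one_sub_cpow (2 * a : ℂ) hx0).summable.norm
  have hint : HasSum (fun j => ∫ s in (-1 : ℝ)..1,
      c j * x₀ ^ j * ((s ^ j * (1 - s ^ 2) ^ (m - 1) : ℝ) : ℂ))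
      (∫ s in (-1 : ℝ)..1, (((1 - s ^ 2) ^ (m - 1) : ℝ) : ℂ) * (1 - s * x₀) ^ (m : ℂ)) := by
    refine intervalIntegral.hasSum_integral_of_dominated_convergence
      (fun j _ => ‖c j * x₀ ^ j‖) ?_ ?_ (.of_forall fun _ _ => hsum) (by simp) ?_
    · intro j
      refine Continuous.aestronglyMeasurable (continuous_const.mul (Complex.continuous_ofReal.comp ?_))
      exact (continuous_pow j).mul ((by fun_prop : Continuous fun t : ℝ => 1 - t ^ 2).rpow_const
        fun _ => Or.inr (by linarith))
    · refine fun j => .of_forall fun s hs => ?_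
      rw [Set.uIoc_of_le (by norm_num)] at hs
      have hs1 : |s| ≤ 1 := abs_le.2 ⟨hs.1.le, hs.2⟩
      have hs2 : 0 ≤ 1 - s ^ 2 := by nlinarith [hs.1, hs.2]
      rw [norm_mul _ (Complex.ofReal _), Complex.norm_real, norm_mul (s ^ j), norm_pow s,
        Real.norm_eq_abs, Real.norm_of_nonneg (Real.rpow_nonneg hs2 _)]
      refine mul_le_of_le_one_right (norm_nonneg _) (mul_le_one₀ (pow_le_one₀ (abs_nonneg s) hs1)
        (Real.rpow_nonneg hs2 _) (Real.rpow_le_one hs2 (by nlinarith) (by linarith)))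
    · refine .of_forall fun s hs => ?_
      rw [Set.uIoc_of_le (by norm_num)] at hs
      have hs1 : ‖(s : ℂ) * x₀‖ < 1 := by
        rw [norm_mul, Complex.norm_real, Real.norm_eq_abs]
        exact lt_of_le_of_lt (mul_le_of_le_one_left (norm_nonneg _) (abs_le.2 ⟨hs.1.le, hs.2⟩)) hx0
      have h := (hasSum_ascPochhammer_one_sub_cpow (2 * a : ℂ) hs1).mul_left
        (((1 - s ^ 2) ^ (m - 1) : ℝ) : ℂ)
      rw [show (m : ℂ) = -(2 * a : ℂ) by rw [hma]; push_cast; ring]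
      refine h.congr_fun fun j => ?_
      simp only [hc]
      push_cast
      ring
  rw [integral_one_sub_sq_rpow_mul_cpow hm] at hint
  simp only [intervalIntegral.integral_const_mul, intervalIntegral.integral_ofReal,
    integral_neg_one_one_pow_mul_one_sub_sq_rpow _ hm] at hint
  rw [← (mul_right_injective₀ (two_ne_zero' ℕ)).hasSum_iff] at hint
  swap
  · intro j hj
    have hodd : Odd j := by
      rw [← Nat.not_even_iff_odd]
      rintro ⟨k, rfl⟩
      exact hj ⟨k, by ring⟩
    simp [hodd.neg_one_pow]
  have hΓm : Gamma m ≠ 0 := (Real.Gamma_pos_of_pos (by linarith)).ne'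
  have hπ : √π ≠ 0 := by positivity
  have hval : (√π * Gamma m)⁻¹ * ((8 / 9) ^ m / 2 * (Gamma (1 / 3) * Gamma m / Gamma (1 / 3 + m) +
      Gamma (2 / 3) * Gamma m / Gamma (2 / 3 + m))) =
      (8 / 9) ^ (-2 * a) / (2 * √π) * (Gamma (1 / 3) / Gamma (1 / 3 - 2 * a) +
        Gamma (2 / 3) / Gamma (2 / 3 - 2 * a)) := by
    rw [← hma, show 1 / 3 - 2 * a = 1 / 3 + m by linarith,
      show 2 / 3 - 2 * a = 2 / 3 + m by linarith]
    field_simp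
  have hmul := hint.mul_left (((√π * Gamma m)⁻¹ : ℝ) : ℂ)
  rw [← Complex.ofReal_mul, hval] at hmul
  refine hmul.congr_fun fun k => ?_
  have hfac := factorial_two_mul_mul_sqrt_pi k
  have hk : ((2 * k).factorial : ℝ) ≠ 0 := by positivity
  have hk' : (k.factorial : ℝ) ≠ 0 := by positivity
  have hreal : (√π * Gamma m)⁻¹ * (4 ^ k / ((2 * k).factorial : ℝ) * ((1 + (-1) ^ (2 * k)) / 2 *
      (Gamma ((((2 * k : ℕ) : ℝ) + 1) / 2) * Gamma m / Gamma ((((2 * k : ℕ) : ℝ) + 1) / 2 + m)))) =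
      (k.factorial : ℝ)⁻¹ * (Gamma (1 / 2 - 2 * a + k))⁻¹ := by
    rw [show (((2 * k : ℕ) : ℝ) + 1) / 2 = k + 1 / 2 by push_cast; ring,
      show 1 / 2 - 2 * a + k = k + 1 / 2 + m by rw [hma]; ring, pow_mul]
    generalize Gamma (k + 1 / 2) = g at hfac ⊢
    field_simp
    linear_combination (-2) * hfac
  have hcomplex := congrArg Complex.ofReal hreal
  simp only [Function.comp_apply, regularizedTerm, hc]
  rw [eval_ascPochhammer_two_mul_double, pow_mul x₀, hx2]
  have hΓ : Complex.Gamma (1 / 2 - 2 * a + k) = (Gamma (1 / 2 - 2 * a + k) : ℝ) := by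
    rw [← Complex.Gamma_ofReal]; push_cast; rfl
  rw [hΓ]
  push_cast at hcomplex ⊢
  linear_combination (-(ascPochhammer ℂ k).eval (a : ℂ) *
    (ascPochhammer ℂ k).eval ((a : ℂ) + 1 / 2) * (-1 / 3) ^ k) * hcomplex

theorem differentiable_regularizedTerm (k : ℕ) :
    Differentiable ℂ fun a => regularizedTerm a k := by
  have hp := (ascPochhammer ℂ k).differentiable
  have hΓ : Differentiable ℂ fun a : ℂ => (Complex.Gamma (1 / 2 - 2 * a + k))⁻¹ :=
    Complex.differentiable_one_div_Gamma.comp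
      (by fun_prop : Differentiable ℂ fun a : ℂ => 1 / 2 - 2 * a + k)
  have hp' : Differentiable ℂ fun a : ℂ => (ascPochhammer ℂ k).eval (a + 1 / 2) :=
    hp.comp (by fun_prop : Differentiable ℂ fun a : ℂ => a + 1 / 2)
  exact (((hp.mul hp').div_const _).mul_const _).mul hΓ

theorem regularizedTerm_succ (a : ℂ) (k : ℕ) (h : 1 / 2 - 2 * a + k ≠ 0) :
    regularizedTerm a (k + 1) = regularizedTerm a k *
      ((a + k) * (a + 1 / 2 + k) / ((k + 1) * (1 / 2 - 2 * a + k)) * (-1 / 3)) := by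
  simp only [regularizedTerm, ascPochhammer_succ_eval, Nat.factorial_succ]
  push_cast
  rw [← add_assoc, Complex.Gamma_add_one _ h]
  simp only [div_eq_mul_inv, mul_inv, pow_succ]
  ring

theorem norm_regularizedTerm_succ_le {R : ℝ} (hR : 0 < R) {a : ℂ} (ha : ‖a‖ ≤ R) {k : ℕ}
    (hk : 20 * (R + 1) ≤ k) :
    ‖regularizedTerm a (k + 1)‖ ≤ 2 / 3 * ‖regularizedTerm a k‖ := by
  have hk0 : (0 : ℝ) < k := by linarith
  have hden : k - 2 * R ≤ ‖1 / 2 - 2 * a + (k : ℂ)‖ := by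
    have h1 : (1 / 2 - 2 * a + (k : ℂ)).re = 1 / 2 - 2 * a.re + k := by simp
    have h2 := Complex.re_le_norm (1 / 2 - 2 * a + (k : ℂ))
    have h3 := Complex.re_le_norm a
    linarith
  have hden0 : 0 < ‖1 / 2 - 2 * a + (k : ℂ)‖ := by linarith
  have hnum1 : ‖a + k‖ ≤ R + k := (norm_add_le _ _).trans (by simpa using ha)
  have hnum2 : ‖a + 1 / 2 + k‖ ≤ R + 1 / 2 + k := by
    have h1 := norm_add₃_le (a := a) (b := 1 / 2) (c := (k : ℂ))
    norm_num at h1 ⊢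
    linarith
  rw [regularizedTerm_succ a k (norm_pos_iff.1 hden0), norm_mul, mul_comm]
  refine mul_le_mul_of_nonneg_right ?_ (norm_nonneg _)
  rw [norm_mul, norm_div, norm_mul, norm_mul]
  have h13 : ‖(-1 / 3 : ℂ)‖ = 1 / 3 := by norm_num
  have hk1 : ‖(k : ℂ) + 1‖ = k + 1 := by
    rw [← Nat.cast_succ, Complex.norm_natCast]; push_cast; ring
  rw [h13, hk1]
  have hq : ‖a + k‖ * ‖a + 1 / 2 + k‖ / ((k + 1) * ‖1 / 2 - 2 * a + (k : ℂ)‖) ≤ 2 := by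
    rw [div_le_iff₀ (by positivity)]
    calc ‖a + k‖ * ‖a + 1 / 2 + k‖ ≤ (R + k) * (R + 1 / 2 + k) := by gcongr
      _ ≤ 2 * ((k + 1) * (k - 2 * R)) := by nlinarith
      _ ≤ _ := by gcongr
  linarith

theorem differentiable_tsum_regularizedTerm :
    Differentiable ℂ fun a => ∑' k, regularizedTerm a k := by
  intro z
  set R : ℝ := ‖z‖ + 1 with hRdef
  have hR : 0 < R := by positivity
  have hbound (k : ℕ) : ∃ M, ∀ a ∈ Metric.closedBall (0 : ℂ) R, ‖regularizedTerm a k‖ ≤ M :=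
    (isCompact_closedBall (0 : ℂ) R).exists_bound_of_continuousOn
      (differentiable_regularizedTerm k).continuous.continuousOn
  choose M hM using hbound
  obtain ⟨K, hK⟩ := exists_nat_ge (20 * (R + 1))
  have hgeom {a : ℂ} (ha : a ∈ Metric.closedBall (0 : ℂ) R) (i : ℕ) :
      ‖regularizedTerm a (i + K)‖ ≤ M K * (2 / 3) ^ i := by
    induction i with
    | zero => simpa using hM K a ha
    | succ i ih =>
      have hle := norm_regularizedTerm_succ_le hR (mem_closedBall_zero_iff.1 ha) (k := i + K)
        (by push_cast; linarith [(Nat.cast_nonneg i : (0 : ℝ) ≤ i)])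
      rw [show i + 1 + K = i + K + 1 by ring, pow_succ]
      linarith
  set u : ℕ → ℝ := fun k => if k < K then M k else M K * (2 / 3) ^ (k - K) with hu
  have husum : Summable u := by
    rw [← summable_nat_add_iff K]
    refine ((summable_geometric_of_lt_one (by norm_num) (by norm_num : (2 / 3 : ℝ) < 1)).mul_left
      (M K)).congr fun i => ?_
    simp [hu]
  have hdiff := Complex.differentiableOn_tsum_of_summable_norm husum (U := Metric.ball (0 : ℂ) R)
    (F := fun k a => regularizedTerm a k)
    (fun k => (differentiable_regularizedTerm k).differentiableOn) Metric.isOpen_ball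
    (fun k a ha => by
      have ha' := Metric.ball_subset_closedBall ha
      simp only [hu]
      split_ifs with hk
      · exact hM k a ha'
      · have h := hgeom ha' (k - K)
        rwa [Nat.sub_add_cancel (not_lt.1 hk)] at h)
  exact hdiff.differentiableAt (Metric.isOpen_ball.mem_nhds (by simp [hRdef]))

open Filter Topology in
theorem tsum_regularizedTerm (a : ℂ) : ∑' k, regularizedTerm a k =
    (8 / 9) ^ (-2 * a) / (2 * (√π : ℝ)) *
      ((Gamma (1 / 3) : ℝ) * (Complex.Gamma (1 / 3 - 2 * a))⁻¹ +
        (Gamma (2 / 3) : ℝ) * (Complex.Gamma (2 / 3 - 2 * a))⁻¹) := by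
  have hg : Differentiable ℂ fun a : ℂ => (8 / 9) ^ (-2 * a) / (2 * (√π : ℝ)) *
      ((Gamma (1 / 3) : ℝ) * (Complex.Gamma (1 / 3 - 2 * a))⁻¹ +
        (Gamma (2 / 3) : ℝ) * (Complex.Gamma (2 / 3 - 2 * a))⁻¹) := by
    have hΓ (c : ℂ) : Differentiable ℂ fun a : ℂ => (Complex.Gamma (c - 2 * a))⁻¹ :=
      Complex.differentiable_one_div_Gamma.comp
        (by fun_prop : Differentiable ℂ fun a : ℂ => c - 2 * a)
    have hpow : Differentiable ℂ fun a : ℂ => (8 / 9 : ℂ) ^ (-2 * a) := fun a =>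
      DifferentiableAt.const_cpow (by fun_prop) (Or.inl (by norm_num))
    exact (hpow.div_const _).mul (((hΓ _).const_mul _).add ((hΓ _).const_mul _))
  refine congrFun (AnalyticOnNhd.eq_of_frequently_eq (z₀ := ((-1 : ℝ) : ℂ))
    (Complex.analyticOnNhd_univ_iff_differentiable.2 differentiable_tsum_regularizedTerm)
    (Complex.analyticOnNhd_univ_iff_differentiable.2 hg) ?_) a
  have htend : Tendsto (fun x : ℝ => (x : ℂ)) (𝓝[≠] (-1)) (𝓝[≠] ((-1 : ℝ) : ℂ)) :=
    Complex.continuous_ofReal.continuousAt.continuousWithinAt.tendsto_nhdsWithin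
      fun x hx => by simpa only [Set.mem_compl_iff, Set.mem_singleton_iff, Complex.ofReal_inj] using hx
  refine htend.frequently (Eventually.frequently ?_)
  filter_upwards [mem_nhdsWithin_of_mem_nhds (Iio_mem_nhds (by norm_num : (-1 : ℝ) < -1 / 2))]
    with x hx
  have h13 : Complex.Gamma (1 / 3 - 2 * x) = (Gamma (1 / 3 - 2 * x) : ℝ) := by
    rw [← Complex.Gamma_ofReal]; push_cast; rfl
  have h23 : Complex.Gamma (2 / 3 - 2 * x) = (Gamma (2 / 3 - 2 * x) : ℝ) := by
    rw [← Complex.Gamma_ofReal]; push_cast; rfl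
  rw [(hasSum_regularizedTerm_of_lt hx).tsum_eq, h13, h23]
  push_cast
  rw [Complex.ofReal_cpow (by norm_num)]
  push_cast
  simp only [div_eq_mul_inv]

theorem Real.Gamma_add_nat_eq_ascPochhammer {c : ℝ} (hc : ∀ k : ℕ, c ≠ -k) (k : ℕ) :
    Gamma (c + k) = (ascPochhammer ℝ k).eval c * Gamma c := by
  induction k with
  | zero => simp
  | succ k ih =>
    have : c + k ≠ 0 := fun h => hc k (by linarith)
    rw [Nat.cast_succ, ← add_assoc, Gamma_add_one this, ih, ascPochhammer_succ_eval]
    ring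

theorem gauss_2F1_special_value_e (a : ℝ)
    (h1 : ∀ k : ℕ, (1 / 2 : ℝ) - 2 * a ≠ -(k : ℝ))
    (h2 : ∀ k : ℕ, (1 / 3 : ℝ) - 2 * a ≠ -(k : ℝ))
    (h3 : ∀ k : ℕ, (2 / 3 : ℝ) - 2 * a ≠ -(k : ℝ))
    (h4 : ∀ k : ℕ, (1 : ℝ) - 6 * a ≠ -(k : ℝ)) :
    ∑' k : ℕ, (ascPochhammer ℝ k).eval a * (ascPochhammer ℝ k).eval (a + 1 / 2) /
        ((ascPochhammer ℝ k).eval (1 / 2 - 2 * a) * (Nat.factorial k : ℝ)) *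
        (-1 / 3 : ℝ) ^ k
      = (6 : ℝ) ^ (-(2 * a)) / 2 *
          (Real.Gamma (1 / 3 - 2 * a) / Real.Gamma (1 / 3) +
            Real.Gamma (2 / 3 - 2 * a) / Real.Gamma (2 / 3)) *
          (Real.Gamma (1 - 4 * a) / Real.Gamma (1 - 6 * a)) := by
  have hD : Gamma (1 / 2 - 2 * a) ≠ 0 := Real.Gamma_ne_zero h1
  have hA : Gamma (1 / 3 - 2 * a) ≠ 0 := Real.Gamma_ne_zero h2
  have hB : Gamma (2 / 3 - 2 * a) ≠ 0 := Real.Gamma_ne_zero h3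
  have hU : Gamma (1 - 2 * a) ≠ 0 := Real.Gamma_ne_zero fun k hk =>
    h4 (3 * k + 2) (by push_cast; linarith)
  have hA₀ : Gamma (1 / 3) ≠ 0 := (Real.Gamma_pos_of_pos (by norm_num)).ne'
  have hB₀ : Gamma (2 / 3) ≠ 0 := (Real.Gamma_pos_of_pos (by norm_num)).ne'
  have hπ : √π ≠ 0 := by positivity
  have heval (k : ℕ) (x : ℝ) : (ascPochhammer ℂ k).eval (x : ℂ) =
      ((ascPochhammer ℝ k).eval x : ℝ) := by
    rw [← ascPochhammer_map Complex.ofRealHom, ← Complex.ofRealHom_eq_coe, eval_map_apply]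
    rfl
  have hterm (k : ℕ) : ((Gamma (1 / 2 - 2 * a))⁻¹ * ((ascPochhammer ℝ k).eval a *
      (ascPochhammer ℝ k).eval (a + 1 / 2) / ((ascPochhammer ℝ k).eval (1 / 2 - 2 * a) *
      (Nat.factorial k : ℝ)) * (-1 / 3 : ℝ) ^ k) : ℝ) = regularizedTerm a k := by
    have hΓ : Complex.Gamma (1 / 2 - 2 * a + k) = (Gamma (1 / 2 - 2 * a + k) : ℝ) := by
      rw [← Complex.Gamma_ofReal]; push_cast; rfl
    have hhalf : (a : ℂ) + 1 / 2 = ((a + 1 / 2 : ℝ) : ℂ) := by push_cast; rfl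
    rw [regularizedTerm, hΓ, Real.Gamma_add_nat_eq_ascPochhammer h1, hhalf, heval, heval]
    push_cast
    simp only [div_eq_mul_inv, mul_inv]
    ring
  have hsum := tsum_regularizedTerm a
  have h13 : Complex.Gamma (1 / 3 - 2 * a) = (Gamma (1 / 3 - 2 * a) : ℝ) := by
    rw [← Complex.Gamma_ofReal]; push_cast; rfl
  have h23 : Complex.Gamma (2 / 3 - 2 * a) = (Gamma (2 / 3 - 2 * a) : ℝ) := by
    rw [← Complex.Gamma_ofReal]; push_cast; rfl
  have h89 : (8 / 9 : ℂ) ^ (-2 * a : ℂ) = (((8 / 9) ^ (-2 * a) : ℝ) : ℂ) := by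
    rw [Complex.ofReal_cpow (by norm_num)]; push_cast; rfl
  simp_rw [← hterm] at hsum
  rw [← Complex.ofReal_tsum, tsum_mul_left, h13, h23, h89] at hsum
  have hreal := Complex.ofReal_injective (hsum.trans (b := _)
    (c := (((8 / 9) ^ (-2 * a) / (2 * √π) * (Gamma (1 / 3) * (Gamma (1 / 3 - 2 * a))⁻¹ +
      Gamma (2 / 3) * (Gamma (2 / 3 - 2 * a))⁻¹) : ℝ) : ℂ)) (by push_cast; rfl))
  rw [inv_mul_eq_iff_eq_mul₀ hD] at hreal
  rw [hreal]
  have hdouble := Real.Gamma_mul_Gamma_add_half (1 / 2 - 2 * a)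
  have htriple := Real.Gamma_mul_Gamma_add_third_mul_Gamma_add_two_thirds (1 / 3 - 2 * a)
  obtain ⟨x, hx⟩ : ∃ x : ℝ, x = 2 ^ (-2 * a) := ⟨_, rfl⟩
  obtain ⟨y, hy⟩ : ∃ y : ℝ, y = 3 ^ (-2 * a) := ⟨_, rfl⟩
  have hx0 : x ≠ 0 := by rw [hx]; positivity
  have hy0 : y ≠ 0 := by rw [hy]; positivity
  have hp89 : (8 / 9 : ℝ) ^ (-2 * a) = x ^ 3 / y ^ 2 := by
    rw [Real.div_rpow (by norm_num) (by norm_num), show (8 : ℝ) = 2 ^ (3 : ℕ) by norm_num,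
      show (9 : ℝ) = 3 ^ (2 : ℕ) by norm_num, ← Real.rpow_pow_comm (by norm_num),
      ← Real.rpow_pow_comm (by norm_num), hx, hy]
  have hp6 : (6 : ℝ) ^ (-(2 * a)) = x * y := by
    rw [show -(2 * a) = -2 * a by ring, show (6 : ℝ) = 2 * 3 by norm_num,
      Real.mul_rpow (by norm_num) (by norm_num), hx, hy]
  have hp2 : (2 : ℝ) ^ (1 - 2 * (1 / 2 - 2 * a)) = (x ^ 2)⁻¹ := by
    rw [hx, ← Real.rpow_mul_natCast (by norm_num), ← Real.rpow_neg (by norm_num)]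
    congr 1; push_cast; ring
  have hp3 : (1 / 3 : ℝ) ^ (3 * (1 / 3 - 2 * a)) = (3 * y ^ 3)⁻¹ := by
    rw [hy, ← Real.rpow_mul_natCast (by norm_num), one_div, Real.inv_rpow (by norm_num),
      show 3 * ((3 : ℝ)⁻¹ - 2 * a) = 1 + -2 * a * (3 : ℕ) by push_cast; ring,
      Real.rpow_add (by norm_num), Real.rpow_one]
  rw [hp2, show 1 / 2 - 2 * a + 1 / 2 = 1 - 2 * a by ring,
    show 2 * (1 / 2 - 2 * a) = 1 - 4 * a by ring] at hdouble
  rw [hp3, show 1 / 3 - 2 * a + 1 / 3 = 2 / 3 - 2 * a by ring,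
    show 1 / 3 - 2 * a + 2 / 3 = 1 - 2 * a by ring,
    show 3 * (1 / 3 - 2 * a) = 1 - 6 * a by ring] at htriple
  have hW : Gamma (1 - 4 * a) = Gamma (1 / 2 - 2 * a) * Gamma (1 - 2 * a) * x ^ 2 / √π := by
    rw [hdouble]; field_simp
  have hT' : Gamma (1 - 6 * a) = Gamma (1 / 3 - 2 * a) * Gamma (2 / 3 - 2 * a) *
      Gamma (1 - 2 * a) * y ^ 3 / (Gamma (1 / 3) * Gamma (2 / 3)) := by
    rw [htriple]; field_simp
  rw [hp89, hp6, hW, hT']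
  generalize Gamma (1 / 2 - 2 * a) = D at *
  generalize Gamma (1 / 3 - 2 * a) = A at *
  generalize Gamma (2 / 3 - 2 * a) = B at *
  generalize Gamma (1 - 2 * a) = U at *
  generalize Gamma (1 / 3) = A₀ at *
  generalize Gamma (2 / 3) = B₀ at *
  field_simp
  ring
end

section
/- For every real a ≥ 1/6, the absolutely convergent series ₃F₂(a, 3a−1/2, 3/2−3a; 3a, 1/2 | 3/4) = ∑_{k≥0} (a)_k (3a−1/2)_k (3/2−3a)_k / ((3a)_k (1/2)_k k!) · (3/4)^k equals Γ(1/6)·Γ(a+1/3)·Γ(a+2/3) / (π·√3·Γ(2a+1/6)) · sin(πa + π/6). -/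
open Polynomial Real

open Set Filter Topology MeasureTheory

theorem convexOn_log_Gamma_affine {c : ℝ} (hc : 0 ≤ c) :
    ConvexOn ℝ (Ioi (0 : ℝ)) fun s => Real.log (Real.Gamma (s / 3 + c)) := by
  refine ⟨convex_Ioi 0, fun x hx y hy p q hp hq hpq => ?_⟩
  have hx' : (0 : ℝ) < x := hx
  have hy' : (0 : ℝ) < y := hy
  have h := Real.convexOn_log_Gamma.2 (show x / 3 + c ∈ Ioi 0 from by simp; positivity)
    (show y / 3 + c ∈ Ioi 0 from by simp; positivity) hp hq hpq
  have e : (p • x + q • y) / 3 + c = p • (x / 3 + c) + q • (y / 3 + c) := by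
    simp only [smul_eq_mul]
    linear_combination (-c) * hpq
  simpa only [e, Function.comp_apply] using h

/-- The **Gauss multiplication formula** for the Gamma function with three factors. -/
theorem Gamma_three_mul {s : ℝ} (hs : 0 < s) :
    Real.Gamma (3 * s) = 3 ^ (3 * s - 1 / 2) / (2 * π) *
      (Real.Gamma s * Real.Gamma (s + 1 / 3) * Real.Gamma (s + 2 / 3)) := by
  set g : ℝ → ℝ := fun x => 3 ^ (x - 1 / 2) / (2 * π) *
    (Real.Gamma (x / 3 + 0) * Real.Gamma (x / 3 + 1 / 3) * Real.Gamma (x / 3 + 2 / 3)) with hg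
  have hpos : ∀ {y : ℝ}, 0 < y → 0 < g y := fun {y} hy => by
    have h0 := Real.Gamma_pos_of_pos (show 0 < y / 3 + 0 by positivity)
    have h1 := Real.Gamma_pos_of_pos (show 0 < y / 3 + 1 / 3 by positivity)
    have h2 := Real.Gamma_pos_of_pos (show 0 < y / 3 + 2 / 3 by positivity)
    simp only [hg]
    positivity
  have hlog : EqOn (fun x => Real.log (Real.Gamma (x / 3 + 0)) +
      Real.log (Real.Gamma (x / 3 + 1 / 3)) + Real.log (Real.Gamma (x / 3 + 2 / 3)) +
      Real.log 3 * x + (- (1 / 2 * Real.log 3) - Real.log (2 * π))) (Real.log ∘ g) (Ioi 0) := by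
    intro y hy
    have hy : 0 < y := hy
    have h0 := Real.Gamma_pos_of_pos (show 0 < y / 3 + 0 by positivity)
    have h1 := Real.Gamma_pos_of_pos (show 0 < y / 3 + 1 / 3 by positivity)
    have h2 := Real.Gamma_pos_of_pos (show 0 < y / 3 + 2 / 3 by positivity)
    simp only [hg, Function.comp_apply]
    rw [Real.log_mul (by positivity) (mul_pos (mul_pos h0 h1) h2).ne',
      Real.log_mul (mul_pos h0 h1).ne' h2.ne',
      Real.log_mul h0.ne' h1.ne', Real.log_div (by positivity) (by positivity),
      Real.log_rpow (by norm_num)]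
    ring
  have hconv : ConvexOn ℝ (Ioi 0) (Real.log ∘ g) := by
    refine ConvexOn.congr ?_ hlog
    refine ((((convexOn_log_Gamma_affine le_rfl).add
      (convexOn_log_Gamma_affine (by norm_num))).add
      (convexOn_log_Gamma_affine (by norm_num))).add ?_).add_const _
    exact (convexOn_id (convex_Ioi (0 : ℝ))).smul (Real.log_pos (by norm_num)).le
  have hfeq : ∀ {y : ℝ}, 0 < y → g (y + 1) = y * g y := fun {y} hy => by
    simp only [hg]
    rw [show (y + 1) / 3 + 0 = y / 3 + 1 / 3 by ring,
      show (y + 1) / 3 + 1 / 3 = y / 3 + 2 / 3 by ring,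
      show (y + 1) / 3 + 2 / 3 = y / 3 + 1 by ring, Real.Gamma_add_one (by positivity),
      show y + 1 - 1 / 2 = y - 1 / 2 + 1 by ring, Real.rpow_add_one (by norm_num), add_zero]
    ring
  have hone : g 1 = 1 := by
    have h := Real.Gamma_mul_Gamma_one_sub (1 / 3)
    rw [show π * (1 / 3) = π / 3 by ring, Real.sin_pi_div_three] at h
    norm_num at h
    simp only [hg]
    norm_num
    rw [h, ← Real.sqrt_eq_rpow]
    field_simp
  have := Real.eq_Gamma_of_log_convex hconv hfeq hpos hone (show 0 < 3 * s by positivity)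
  rw [← this]
  simp only [hg]
  rw [mul_div_cancel_left₀ _ (by norm_num), add_zero]

theorem integrableOn_beta {u v : ℝ} (hu : 0 < u) (hv : 0 < v) :
    IntegrableOn (fun t : ℝ => t ^ (u - 1) * (1 - t) ^ (v - 1)) (Ioo 0 1) := by
  have h := Complex.betaIntegral_convergent (u := u) (v := v) (by simpa) (by simpa)
  rw [intervalIntegrable_iff_integrableOn_Ioo_of_le zero_le_one] at h
  refine h.norm.congr ?_
  filter_upwards [ae_restrict_mem measurableSet_Ioo] with t ht
  have h1 : 0 < 1 - t := by linarith [ht.2]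
  rw [norm_mul, Complex.norm_cpow_eq_rpow_re_of_pos ht.1,
    show (1 - t : ℂ) = ((1 - t : ℝ) : ℂ) by push_cast; rfl, Complex.norm_cpow_eq_rpow_re_of_pos h1]
  simp

theorem integral_beta {u v : ℝ} (hu : 0 < u) (hv : 0 < v) :
    ∫ t in Ioo (0 : ℝ) 1, t ^ (u - 1) * (1 - t) ^ (v - 1) =
      Real.Gamma u * Real.Gamma v / Real.Gamma (u + v) := by
  have h := Complex.betaIntegral_eq_Gamma_mul_div u v (by simpa) (by simpa)
  rw [Complex.betaIntegral, intervalIntegral.integral_of_le zero_le_one,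
    integral_Ioc_eq_integral_Ioo] at h
  have e : ∫ t in Ioo (0 : ℝ) 1, (t : ℂ) ^ ((u : ℂ) - 1) * (1 - (t : ℂ)) ^ ((v : ℂ) - 1) =
      ∫ t in Ioo (0 : ℝ) 1, ((t ^ (u - 1) * (1 - t) ^ (v - 1) : ℝ) : ℂ) := by
    refine setIntegral_congr_fun measurableSet_Ioo fun t ht => ?_
    have h1 : 0 ≤ 1 - t := by linarith [ht.2]
    simp only [Complex.ofReal_mul, Complex.ofReal_cpow ht.1.le, Complex.ofReal_cpow h1]
    push_cast
    rfl
  rw [e, integral_complex_ofReal, Complex.Gamma_ofReal, Complex.Gamma_ofReal, ← Complex.ofReal_add,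
    Complex.Gamma_ofReal] at h
  exact_mod_cast h

theorem summable_succ_mul_of_ratio_tendsto_one {f q : ℕ → ℝ} (hf : ∀ k, f (k + 1) = q k * f k)
    (hq : Tendsto q atTop (𝓝 1)) {r : ℝ} (hr0 : 0 ≤ r) (hr : r < 1) :
    Summable fun k : ℕ => (k + 1) * |f k| * r ^ k := by
  have h1 : Tendsto (fun k : ℕ => ((k : ℝ) + 2) / (k + 1)) atTop (𝓝 1) := by
    have := (tendsto_one_div_add_atTop_nhds_zero_nat (𝕜 := ℝ)).const_add 1
    rw [add_zero] at this
    refine this.congr fun k => ?_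
    have : (k : ℝ) + 1 ≠ 0 := by positivity
    field_simp
    ring
  have h2 : Tendsto (fun k : ℕ => ((k : ℝ) + 2) / (k + 1) * |q k| * r) atTop (𝓝 r) := by
    simpa using (h1.mul hq.abs).mul_const r
  refine summable_of_ratio_norm_eventually_le (r := (1 + r) / 2) (by linarith) ?_
  filter_upwards [h2.eventually_le_const (show r < (1 + r) / 2 by linarith)] with k hk
  have e : (((k + 1 : ℕ) : ℝ) + 1) * |f (k + 1)| * r ^ (k + 1) =
      ((k : ℝ) + 2) / (k + 1) * |q k| * r * ((k + 1) * |f k| * r ^ k) := by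
    have : (k : ℝ) + 1 ≠ 0 := by positivity
    rw [hf, abs_mul, pow_succ]
    push_cast
    field_simp
    ring
  rw [e, norm_mul, Real.norm_of_nonneg (by positivity)]
  gcongr

theorem summable_mul_pow_of_summable_succ_mul {f : ℕ → ℝ}
    (hf : ∀ r : ℝ, 0 ≤ r → r < 1 → Summable fun k : ℕ => (k + 1) * |f k| * r ^ k)
    {x : ℝ} (hx : |x| < 1) : Summable fun k => f k * x ^ k := by
  refine .of_norm_bounded (hf |x| (abs_nonneg x) hx) fun k => ?_
  rw [norm_mul, norm_pow, Real.norm_eq_abs, Real.norm_eq_abs]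
  gcongr
  exact le_mul_of_one_le_left (abs_nonneg _) (by simp)

theorem hasDerivAt_tsum_mul_pow {f : ℕ → ℝ}
    (hf : ∀ r : ℝ, 0 ≤ r → r < 1 → Summable fun k : ℕ => (k + 1) * |f k| * r ^ k)
    {x : ℝ} (hx : |x| < 1) :
    ∃ D, HasDerivAt (fun y => ∑' k, f k * y ^ k) D x ∧
      HasSum (fun k : ℕ => (k + 1) * f (k + 1) * x ^ k) D ∧
      HasSum (fun k : ℕ => k * f k * x ^ k) (x * D) := by
  obtain ⟨r, hxr, hr⟩ := exists_between hx
  have hr0 : 0 ≤ r := (abs_nonneg x).trans hxr.le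
  obtain ⟨s, hrs, hs⟩ := exists_between hr
  have hs0 : 0 < s := hr0.trans_lt hrs
  have hu : Summable fun k : ℕ => s⁻¹ * ((k + 1) * |f k| * s ^ k) := (hf s hs0.le hs).mul_left _
  have hb : ∀ (k : ℕ), ∀ y ∈ Ioo (-r) r,
      ‖f k * (k * y ^ (k - 1))‖ ≤ s⁻¹ * ((k + 1) * |f k| * s ^ k) := by
    intro k y hy
    have hy' : |y| ≤ s := (abs_lt.2 hy).le.trans hrs.le
    rcases k with _ | k
    · simp; positivity
    · rw [norm_mul, norm_mul, norm_pow, Real.norm_natCast, Real.norm_eq_abs, Real.norm_eq_abs,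
        Nat.add_sub_cancel, pow_succ]
      have : |y| ^ k ≤ s ^ k := by gcongr
      calc |f (k + 1)| * (((k + 1 : ℕ) : ℝ) * |y| ^ k)
          ≤ |f (k + 1)| * ((((k + 1 : ℕ) : ℝ) + 1) * s ^ k) := by gcongr; linarith
        _ = _ := by field_simp
  have hxm : x ∈ Ioo (-r) r := abs_lt.1 hxr
  have hd := hasDerivAt_tsum_of_isPreconnected (g := fun k y => f k * y ^ k)
    (g' := fun k y => f k * (k * y ^ (k - 1))) hu isOpen_Ioo isPreconnected_Ioo
    (fun k y _ => (hasDerivAt_pow k y).const_mul (f k)) hb hxm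
    (summable_mul_pow_of_summable_succ_mul hf hx) hxm
  have hsum : Summable fun k : ℕ => f k * (k * x ^ (k - 1)) :=
    .of_norm_bounded hu fun k => hb k x hxm
  refine ⟨_, hd, ?_, ?_⟩
  · have := (hasSum_nat_add_iff' 1).2 hsum.hasSum
    simp only [Finset.range_one, Finset.sum_singleton, Nat.cast_zero, zero_mul, mul_zero,
      sub_zero] at this
    refine HasSum.congr_fun this fun k => ?_
    push_cast
    ring
  · refine HasSum.congr_fun (hsum.hasSum.mul_left x) fun k => ?_
    rcases k with _ | k
    · simp
    · rw [Nat.add_sub_cancel, pow_succ]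
      ring

/-- `cos (m θ) = cos θ · ₂F₁((1 + m) / 2, (1 - m) / 2; 1 / 2 | sin² θ)`, where the coefficients of
the hypergeometric series are characterised by their recurrence. -/
theorem hasSum_cos_mul_div_cos {f : ℕ → ℝ} {m : ℝ} (h0 : f 0 = 1)
    (hf : ∀ k : ℕ, (2 * k + 1) * (2 * k + 2) * f (k + 1) = ((2 * k + 1) ^ 2 - m ^ 2) * f k)
    {θ : ℝ} (hθ : θ ∈ Ioo (-(π / 2)) (π / 2)) :
    HasSum (fun k => f k * (sin θ ^ 2) ^ k) (cos (m * θ) / cos θ) := by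
  set q : ℕ → ℝ := fun k => (1 - (m / (2 * k + 1)) ^ 2) * ((2 * k + 1) / (2 * k + 2)) with hqdef
  have hlim : Tendsto (fun k : ℕ => 2 * (k : ℝ) + 1) atTop atTop :=
    tendsto_atTop_add_const_right _ _
      (tendsto_natCast_atTop_atTop.const_mul_atTop (by norm_num))
  have hq : Tendsto q atTop (𝓝 1) := by
    have h1 := ((hlim.const_div_atTop m).pow 2).const_sub 1
    have h2 : Tendsto (fun k : ℕ => (2 * (k : ℝ) + 1) / (2 * k + 2)) atTop (𝓝 1) := by
      have := ((tendsto_atTop_add_const_right _ 1 hlim).const_div_atTop 1).const_sub 1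
      rw [sub_zero] at this
      refine this.congr fun k => ?_
      field_simp
      ring
    simpa using h1.mul h2
  have hfq : ∀ k, f (k + 1) = q k * f k := fun k => by
    have h : (2 * (k : ℝ) + 1) * (2 * k + 2) ≠ 0 := by positivity
    refine mul_left_cancel₀ h ?_
    rw [hf k, hqdef]
    field_simp
  have hF : ∀ r : ℝ, 0 ≤ r → r < 1 → Summable fun k : ℕ => (k + 1) * |f k| * r ^ k :=
    fun r hr0 hr => summable_succ_mul_of_ratio_tendsto_one hfq hq hr0 hr
  set h : ℕ → ℝ := fun k => f k / (2 * k + 1) with hh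
  have hH : ∀ r : ℝ, 0 ≤ r → r < 1 → Summable fun k : ℕ => (k + 1) * |h k| * r ^ k := by
    intro r hr0 hr
    refine .of_nonneg_of_le (fun k => by positivity) (fun k => ?_) (hF r hr0 hr)
    have : |h k| ≤ |f k| := by
      rw [hh, abs_div, abs_of_nonneg (by positivity : (0 : ℝ) ≤ 2 * k + 1)]
      exact div_le_self (abs_nonneg _) (by linarith [(Nat.cast_nonneg k : (0 : ℝ) ≤ k)])
    gcongr
  set F : ℝ → ℝ := fun x => ∑' k, f k * x ^ k with hFdef
  set H : ℝ → ℝ := fun x => ∑' k, h k * x ^ k with hHdef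
  set I := Ioo (-(π / 2)) (π / 2)
  have hsin : ∀ t ∈ I, |sin t ^ 2| < 1 := fun t ht => by
    rw [abs_of_nonneg (sq_nonneg _)]
    have := cos_pos_of_mem_Ioo ht
    nlinarith [sin_sq_add_cos_sq t, pow_pos this 2]
  have hsq : ∀ t, HasDerivAt (fun t => sin t ^ 2) (2 * sin t * cos t) t := fun t => by
    simpa using! (hasDerivAt_sin t).fun_pow 2
  have hP : ∀ t ∈ I, HasDerivAt (fun t => cos t * F (sin t ^ 2))
      (-m ^ 2 * (sin t * H (sin t ^ 2))) t := fun t ht => by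
    obtain ⟨D, hD, hD1, hD2⟩ := hasDerivAt_tsum_mul_pow hF (hsin t ht)
    have sF := (summable_mul_pow_of_summable_succ_mul hF (hsin t ht)).hasSum
    have sH := (summable_mul_pow_of_summable_succ_mul hH (hsin t ht)).hasSum
    have key : 2 * D - 2 * (sin t ^ 2 * D) - F (sin t ^ 2) = -m ^ 2 * H (sin t ^ 2) := by
      refine (((hD1.mul_left 2).sub (hD2.mul_left 2)).sub sF).unique ?_
      refine HasSum.congr_fun (sH.mul_left (-m ^ 2)) fun k => ?_
      have e := hf k
      have : (2 * (k : ℝ) + 1) ≠ 0 := by positivity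
      simp only [hh]
      field_simp
      linear_combination (sin t ^ 2) ^ k * e
    refine ((hasDerivAt_cos t).mul (HasDerivAt.comp t hD (hsq t))).congr_deriv ?_
    simp only [Function.comp_apply]
    linear_combination sin t * key + 2 * D * sin t * (sin_sq_add_cos_sq t)
  have hQ : ∀ t ∈ I, HasDerivAt (fun t => sin t * H (sin t ^ 2))
      (cos t * F (sin t ^ 2)) t := fun t ht => by
    obtain ⟨D, hD, hD1, hD2⟩ := hasDerivAt_tsum_mul_pow hH (hsin t ht)
    have sF := (summable_mul_pow_of_summable_succ_mul hF (hsin t ht)).hasSum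
    have sH := (summable_mul_pow_of_summable_succ_mul hH (hsin t ht)).hasSum
    have key : 2 * (sin t ^ 2 * D) + H (sin t ^ 2) = F (sin t ^ 2) := by
      refine ((hD2.mul_left 2).add sH).unique ?_
      refine HasSum.congr_fun sF fun k => ?_
      have : (2 * (k : ℝ) + 1) ≠ 0 := by positivity
      simp only [hh]
      field_simp
    refine ((hasDerivAt_sin t).mul (HasDerivAt.comp t hD (hsq t))).congr_deriv ?_
    simp only [Function.comp_apply]
    linear_combination cos t * key
  have hc : ∀ t, HasDerivAt (fun t => cos (m * t)) (-m * sin (m * t)) t := fun t => by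
    have := (hasDerivAt_cos (m * t)).comp t ((hasDerivAt_id t).const_mul m)
    refine this.congr_deriv ?_
    ring
  have hs : ∀ t, HasDerivAt (fun t => sin (m * t)) (m * cos (m * t)) t := fun t => by
    have := (hasDerivAt_sin (m * t)).comp t ((hasDerivAt_id t).const_mul m)
    refine this.congr_deriv ?_
    ring
  have h0I : (0 : ℝ) ∈ I := ⟨by linarith [pi_pos], by linarith [pi_pos]⟩
  have hF0 : F 0 = 1 := by
    rw [hFdef]
    simp only
    rw [tsum_eq_single 0 (fun k hk => by simp [hk])]
    simp [h0]
  have constant : ∀ G : ℝ → ℝ, (∀ t ∈ I, HasDerivAt G 0 t) → G θ = G 0 := fun G hG =>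
    isOpen_Ioo.is_const_of_deriv_eq_zero isPreconnected_Ioo
      (fun t ht => (hG t ht).differentiableAt.differentiableWithinAt)
      (fun t ht => (hG t ht).deriv) hθ h0I
  have hA := constant (fun t => cos t * F (sin t ^ 2) * cos (m * t) +
      m * (sin t * H (sin t ^ 2)) * sin (m * t)) fun t ht =>
    (((hP t ht).mul (hc t)).add (((hQ t ht).const_mul m).mul (hs t))).congr_deriv (by ring)
  have hB := constant (fun t => cos t * F (sin t ^ 2) * sin (m * t) -
      m * (sin t * H (sin t ^ 2)) * cos (m * t)) fun t ht =>
    (((hP t ht).mul (hs t)).sub (((hQ t ht).const_mul m).mul (hc t))).congr_deriv (by ring)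
  simp only [mul_zero, sin_zero, cos_zero, zero_mul, ne_eq, OfNat.ofNat_ne_zero,
    not_false_eq_true, zero_pow, hF0, mul_one, add_zero, sub_zero] at hA hB
  have hcos := (cos_pos_of_mem_Ioo hθ).ne'
  have hval : F (sin θ ^ 2) = cos (m * θ) / cos θ := by
    rw [eq_div_iff hcos]
    linear_combination cos (m * θ) * hA + sin (m * θ) * hB -
      cos θ * F (sin θ ^ 2) * sin_sq_add_cos_sq (m * θ)
  rw [← hval]
  exact (summable_mul_pow_of_summable_succ_mul hF (hsin θ hθ)).hasSum

theorem hasSum_mul_integral_mul_pow {𝕜 : Type*} [RCLike 𝕜] {μ : Measure ℝ} {w z g : ℝ → 𝕜}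
    {c : ℕ → 𝕜} (hw : Integrable w μ) (hz : AEStronglyMeasurable z μ) (hz1 : ∀ᵐ x ∂μ, ‖z x‖ ≤ 1)
    (hc : Summable fun k => ‖c k‖) (hg : ∀ᵐ x ∂μ, HasSum (fun k => c k * z x ^ k) (g x)) :
    HasSum (fun k => c k * ∫ x, w x * z x ^ k ∂μ) (∫ x, w x * g x ∂μ) := by
  simp_rw [← integral_const_mul]
  refine hasSum_integral_of_dominated_convergence (fun k x => ‖c k‖ * ‖w x‖)
    (fun k => (hw.aestronglyMeasurable.mul (hz.pow k)).const_mul _) (fun k => ?_)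
    (ae_of_all _ fun x => hc.mul_right _) ?_ ?_
  · filter_upwards [hz1] with x hx
    rw [norm_mul, norm_mul, norm_pow]
    gcongr
    exact mul_le_of_le_one_right (norm_nonneg _) (pow_le_one₀ (norm_nonneg _) hx)
  · simp_rw [tsum_mul_right]
    exact hw.norm.const_mul _
  · filter_upwards [hg] with x hx
    refine (hx.mul_left (w x)).congr_fun fun k => ?_
    ring

theorem hasSum_choose_mul_pow (s : ℂ) {z : ℂ} (hz : ‖z‖ < 1) :
    HasSum (fun k => Ring.choose s k * z ^ k) ((1 + z) ^ s) := by
  have h := (Complex.one_add_cpow_hasFPowerSeriesOnBall_zero (a := s)).hasSum (y := z)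
    (by simpa [← ENNReal.ofReal_one, Metric.eball_ofReal] using hz)
  rw [zero_add] at h
  refine h.congr_fun fun k => ?_
  simp [binomialSeries, FormalMultilinearSeries.ofScalars]

theorem integral_exp_two_mul_add_nat {p : ℝ} (hp : 0 < p) (k : ℕ) :
    ∫ x in Ioo (-(π / 2)) (π / 2), Complex.exp (2 * p * x * Complex.I) *
      Complex.exp (2 * x * Complex.I) ^ k = (-1) ^ k * sin (π * p) / (p + k) := by
  have hpk : (p : ℂ) + k ≠ 0 := by
    exact_mod_cast (by positivity : p + k ≠ 0)
  have hc : (2 * (p + k) * Complex.I : ℂ) ≠ 0 :=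
    mul_ne_zero (mul_ne_zero two_ne_zero hpk) Complex.I_ne_zero
  have e : ∀ x : ℝ, Complex.exp (2 * p * x * Complex.I) * Complex.exp (2 * x * Complex.I) ^ k =
      Complex.exp (2 * (p + k) * Complex.I * x) := fun x => by
    rw [← Complex.exp_nat_mul, ← Complex.exp_add]
    ring_nf
  simp_rw [e]
  rw [← integral_Ioc_eq_integral_Ioo, ← intervalIntegral.integral_of_le (by linarith [pi_pos]),
    integral_exp_mul_complex hc,
    show 2 * (p + k) * Complex.I * ((π / 2 : ℝ) : ℂ) = ((π * p + k * π : ℝ) : ℂ) * Complex.I by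
      push_cast; ring,
    show 2 * (p + k) * Complex.I * ((-(π / 2) : ℝ) : ℂ) =
      ((-(π * p + k * π) : ℝ) : ℂ) * Complex.I by push_cast; ring,
    Complex.exp_ofReal_mul_I, Complex.exp_ofReal_mul_I, cos_neg, sin_neg, sin_add_nat_mul_pi]
  push_cast
  field_simp
  ring

theorem integral_rpow_mul_neg_pow {p : ℝ} (hp : 0 < p) (k : ℕ) :
    ∫ t in Ioo (0 : ℝ) 1, ((t ^ (p - 1) : ℝ) : ℂ) * (-(t : ℂ)) ^ k = (-1) ^ k / (p + k) := by
  have e : ∀ t ∈ Ioo (0 : ℝ) 1, ((t ^ (p - 1) : ℝ) : ℂ) * (-(t : ℂ)) ^ k =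
      (-1) ^ k * ((t ^ (p - 1 + k) : ℝ) : ℂ) := fun t ht => by
    rw [rpow_add_natCast ht.1.ne', neg_pow]
    push_cast
    ring
  have hk : (0 : ℝ) ≤ k := Nat.cast_nonneg k
  rw [setIntegral_congr_fun measurableSet_Ioo e, integral_const_mul, integral_complex_ofReal,
    ← integral_Ioc_eq_integral_Ioo, ← intervalIntegral.integral_of_le zero_le_one,
    integral_rpow (.inl (by linarith)), one_rpow, zero_rpow (by linarith),
    show p - 1 + k + 1 = p + k by ring]
  push_cast
  ring

theorem integral_one_add_mul_exp_cpow {p : ℝ} (hp : 0 < p) (s : ℂ) {r : ℝ} (hr0 : 0 ≤ r)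
    (hr : r < 1) :
    ∫ x in Ioo (-(π / 2)) (π / 2), Complex.exp (2 * p * x * Complex.I) *
      (1 + r * Complex.exp (2 * x * Complex.I)) ^ s =
    sin (π * p) * ∫ t in Ioo (0 : ℝ) 1, ((t ^ (p - 1) : ℝ) : ℂ) * (1 + r * -(t : ℂ)) ^ s := by
  have hrn : ‖(r : ℂ)‖ = r := by simp [hr0]
  have hc : Summable fun k => ‖Ring.choose s k * (r : ℂ) ^ k‖ :=
    (hasSum_choose_mul_pow s (z := (r : ℂ)) (by rwa [hrn])).summable.norm
  have hser : ∀ z : ℂ, ‖z‖ ≤ 1 →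
      HasSum (fun k => Ring.choose s k * (r : ℂ) ^ k * z ^ k) ((1 + r * z) ^ s) := fun z hz => by
    refine (hasSum_choose_mul_pow s (z := r * z) ?_).congr_fun fun k => by rw [mul_pow, mul_assoc]
    rw [norm_mul, hrn]
    exact (mul_le_of_le_one_right hr0 hz).trans_lt hr
  have hexp : ∀ x : ℝ, ‖Complex.exp (2 * x * Complex.I)‖ ≤ 1 := fun x => by
    have := Complex.norm_exp_ofReal_mul_I (2 * x)
    push_cast at this
    exact this.le
  have h1 := hasSum_mul_integral_mul_pow (μ := volume.restrict (Ioo (-(π / 2)) (π / 2)))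
    (w := fun x : ℝ => Complex.exp (2 * p * x * Complex.I))
    (z := fun x : ℝ => Complex.exp (2 * x * Complex.I))
    (g := fun x : ℝ => (1 + r * Complex.exp (2 * x * Complex.I)) ^ s)
    (((by fun_prop : Continuous fun x : ℝ => Complex.exp (2 * p * x * Complex.I)).integrableOn_Icc
      (a := -(π / 2)) (b := π / 2)).mono_set Ioo_subset_Icc_self)
    (by fun_prop) (ae_of_all _ hexp) hc (ae_of_all _ fun x => hser _ (hexp x))
  have hw : IntegrableOn (fun t : ℝ => t ^ (p - 1)) (Ioo 0 1) :=
    (intervalIntegrable_iff_integrableOn_Ioo_of_le zero_le_one).1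
      (intervalIntegral.intervalIntegrable_rpow' (by linarith))
  have hz : ∀ᵐ t : ℝ ∂volume.restrict (Ioo 0 1), ‖-(t : ℂ)‖ ≤ 1 := by
    filter_upwards [ae_restrict_mem measurableSet_Ioo] with t ht
    simpa [abs_of_pos ht.1] using ht.2.le
  have h2 := hasSum_mul_integral_mul_pow (μ := volume.restrict (Ioo (0 : ℝ) 1))
    (w := fun t : ℝ => ((t ^ (p - 1) : ℝ) : ℂ)) (z := fun t : ℝ => -(t : ℂ))
    (g := fun t : ℝ => (1 + r * -(t : ℂ)) ^ s) hw.ofReal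
    (by fun_prop) hz hc (hz.mono fun t ht => hser _ ht)
  refine h1.unique ((h2.mul_left _).congr_fun fun k => ?_)
  rw [integral_exp_two_mul_add_nat hp, integral_rpow_mul_neg_pow hp]
  ring

theorem rpow_le_two_rpow_add_rpow {s c y : ℝ} (hc : 0 < c) (hcy : c ≤ y) (hy : y ≤ 2) :
    y ^ s ≤ 2 ^ s + c ^ s := by
  have h2 : (0 : ℝ) ≤ 2 ^ s := by positivity
  have h3 : 0 ≤ c ^ s := by positivity
  rcases le_total 0 s with hs | hs
  · linarith [rpow_le_rpow (hc.le.trans hcy) hy hs]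
  · linarith [rpow_le_rpow_of_nonpos hc hcy hs]

theorem integrableOn_one_add_mul_rpow {s : ℝ} (hs : -1 < s) {ε : ℝ} (hε : ε = 1 ∨ ε = -1) :
    IntegrableOn (fun x : ℝ => (1 + ε * (2 / π) * x) ^ s) (Ioo (-(π / 2)) (π / 2)) := by
  have hπ := pi_pos
  have h : IntervalIntegrable (fun x : ℝ => (1 + ε * (2 / π) * x) ^ s) volume
      (-(π / 2)) (π / 2) := by
    rcases hε with rfl | rfl
    · have := ((intervalIntegral.intervalIntegrable_rpow' hs (a := 0) (b := 2)).comp_add_left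
        1).comp_mul_left (c := 2 / π)
      convert this using 1
      · simp
      · field_simp; norm_num
      · field_simp; norm_num
    · have := ((intervalIntegral.intervalIntegrable_rpow' hs (a := 2) (b := 0)).comp_add_left
        1).comp_mul_left (c := -1 * (2 / π))
      convert this using 1
      · field_simp; norm_num
      · field_simp; norm_num
  exact (intervalIntegrable_iff_integrableOn_Ioo_of_le (by linarith)).1 h

theorem norm_one_add_mul_exp_rpow_le {s r x : ℝ} (hr0 : 0 ≤ r) (hr : r ≤ 1)
    (hx : x ∈ Ioo (-(π / 2)) (π / 2)) :
    ‖1 + r * Complex.exp (2 * x * Complex.I)‖ ^ s ≤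
      2 ^ s + ((1 + 1 * (2 / π) * x) ^ s + (1 + -1 * (2 / π) * x) ^ s) := by
  have hπ := pi_pos
  have hcos := cos_pos_of_mem_Ioo hx
  have e : Complex.exp (2 * x * Complex.I) =
      Complex.exp (x * Complex.I) * Complex.exp (x * Complex.I) := by
    rw [← Complex.exp_add]; ring_nf
  have hle : ‖1 + r * Complex.exp (2 * x * Complex.I)‖ ≤ 2 := by
    refine (norm_add_le _ _).trans ?_
    rw [e, norm_mul, norm_mul, Complex.norm_exp_ofReal_mul_I]
    simp [abs_of_nonneg hr0]
    linarith
  have hge : cos x ≤ ‖1 + r * Complex.exp (2 * x * Complex.I)‖ := by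
    have h1 : ‖1 + r * Complex.exp (2 * x * Complex.I)‖ =
        ‖Complex.exp ((-x : ℝ) * Complex.I) + r * Complex.exp (x * Complex.I)‖ := by
      rw [← one_mul ‖1 + _‖, ← Complex.norm_exp_ofReal_mul_I (-x), ← norm_mul, mul_add, e,
        mul_one, mul_left_comm, ← mul_assoc (Complex.exp ((-x : ℝ) * Complex.I)), ← Complex.exp_add]
      simp
    rw [h1]
    refine le_trans ?_ (Complex.re_le_norm _)
    rw [Complex.exp_ofReal_mul_I, Complex.exp_ofReal_mul_I]
    simp [-Complex.ofReal_cos, -Complex.ofReal_sin]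
    positivity
  have hlin : |2 / π * x| < 1 := by
    rw [abs_mul, abs_of_pos (by positivity : 0 < 2 / π), div_mul_eq_mul_div, div_lt_one hπ]
    linarith [abs_lt.2 hx]
  obtain ⟨hl1, hl2⟩ := abs_lt.1 hlin
  have hp1 : 0 < 1 + 1 * (2 / π) * x := by linarith
  have hp2 : 0 < 1 + -1 * (2 / π) * x := by linarith
  have hn1 := rpow_nonneg hp1.le s
  have hn2 := rpow_nonneg hp2.le s
  rcases le_total 0 x with h0 | h0
  · have := rpow_le_two_rpow_add_rpow (s := s) hp2
      (le_trans (by linarith [one_sub_mul_le_cos h0 hx.2.le]) hge) hle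
    linarith
  · have := rpow_le_two_rpow_add_rpow (s := s) hp1
      (le_trans (by linarith [one_add_mul_le_cos hx.1.le h0]) hge) hle
    linarith

theorem one_add_exp_cpow (s : ℝ) {x : ℝ} (hx : x ∈ Ioo (-(π / 2)) (π / 2)) :
    (1 + Complex.exp (2 * x * Complex.I)) ^ (s : ℂ) =
      (((2 * cos x) ^ s : ℝ) : ℂ) * Complex.exp (s * x * Complex.I) := by
  have hcos : 0 < 2 * cos x := by linarith [cos_pos_of_mem_Ioo hx]
  have e : 1 + Complex.exp (2 * x * Complex.I) =
      ((2 * cos x : ℝ) : ℂ) * Complex.exp (x * Complex.I) := by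
    push_cast
    rw [Complex.two_cos, add_mul, ← Complex.exp_add, ← Complex.exp_add]
    ring_nf
    simp [add_comm]
  have hne : ((2 * cos x : ℝ) : ℂ) ≠ 0 := by exact_mod_cast hcos.ne'
  have him : ((x : ℂ) * Complex.I).im = x := by simp
  rw [e, Complex.cpow_def_of_ne_zero (mul_ne_zero hne (Complex.exp_ne_zero _)),
    Complex.log_ofReal_mul hcos (Complex.exp_ne_zero _),
    Complex.log_exp (by rw [him]; linarith [hx.1, pi_pos]) (by rw [him]; linarith [hx.2, pi_pos]),
    rpow_def_of_pos hcos, Complex.ofReal_exp, ← Complex.exp_add]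
  push_cast
  ring_nf

theorem integral_exp_mul_one_add_exp_cpow {p s : ℝ} (hp : 0 < p) (hs : -1 < s) :
    IntegrableOn (fun x : ℝ => Complex.exp (2 * p * x * Complex.I) *
      (1 + Complex.exp (2 * x * Complex.I)) ^ (s : ℂ)) (Ioo (-(π / 2)) (π / 2)) ∧
    ∫ x in Ioo (-(π / 2)) (π / 2), Complex.exp (2 * p * x * Complex.I) *
      (1 + Complex.exp (2 * x * Complex.I)) ^ (s : ℂ) =
    ((sin (π * p) * (Gamma p * Gamma (s + 1) / Gamma (p + (s + 1))) : ℝ) : ℂ) := by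
  set B : ℝ → ℝ := fun x => 2 ^ s + ((1 + 1 * (2 / π) * x) ^ s + (1 + -1 * (2 / π) * x) ^ s)
  have hB : IntegrableOn B (Ioo (-(π / 2)) (π / 2)) :=
    (integrableOn_const (by simp)).add ((integrableOn_one_add_mul_rpow hs (.inl rfl)).add
      (integrableOn_one_add_mul_rpow hs (.inr rfl)))
  have hnorm : ∀ {r x : ℝ}, 0 ≤ r → r ≤ 1 → x ∈ Ioo (-(π / 2)) (π / 2) →
      ‖Complex.exp (2 * p * x * Complex.I) *
        (1 + r * Complex.exp (2 * x * Complex.I)) ^ (s : ℂ)‖ ≤ B x := fun {r x} hr0 hr hx => by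
    have := Complex.norm_exp_ofReal_mul_I (2 * p * x)
    push_cast at this
    rw [norm_mul, this, one_mul, Complex.norm_cpow_real]
    exact norm_one_add_mul_exp_rpow_le hr0 hr hx
  have hnear : ∀ᶠ r : ℝ in 𝓝[<] 1, r ∈ Ioo 0 1 := Ioo_mem_nhdsLT zero_lt_one
  refine ⟨Integrable.mono' hB (by fun_prop) ?_, ?_⟩
  · filter_upwards [ae_restrict_mem measurableSet_Ioo] with x hx
    simpa using hnorm zero_le_one le_rfl hx
  have hL : Tendsto (fun r : ℝ => ∫ x in Ioo (-(π / 2)) (π / 2),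
      Complex.exp (2 * p * x * Complex.I) *
        (1 + r * Complex.exp (2 * x * Complex.I)) ^ (s : ℂ)) (𝓝[<] 1)
      (𝓝 (∫ x in Ioo (-(π / 2)) (π / 2), Complex.exp (2 * p * x * Complex.I) *
        (1 + Complex.exp (2 * x * Complex.I)) ^ (s : ℂ))) := by
    refine tendsto_integral_filter_of_dominated_convergence B
      (.of_forall fun r => by fun_prop) ?_ hB ?_
    · filter_upwards [hnear] with r hr
      filter_upwards [ae_restrict_mem measurableSet_Ioo] with x hx
      exact hnorm hr.1.le hr.2.le hx
    · filter_upwards [ae_restrict_mem measurableSet_Ioo] with x hx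
      have hslit : 1 + ((1 : ℝ) : ℂ) * Complex.exp (2 * x * Complex.I) ∈ Complex.slitPlane := by
        left
        have h := Complex.exp_ofReal_mul_I_re (2 * x)
        push_cast at h
        rw [Complex.ofReal_one, one_mul, Complex.add_re, Complex.one_re, h, cos_two_mul]
        have := cos_pos_of_mem_Ioo hx
        have := pow_pos this 2
        linarith
      have hcont : ContinuousAt (fun r : ℝ => Complex.exp (2 * p * x * Complex.I) *
          (1 + r * Complex.exp (2 * x * Complex.I)) ^ (s : ℂ)) 1 :=
        continuousAt_const.mul (ContinuousAt.cpow (by fun_prop) continuousAt_const hslit)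
      have := hcont.tendsto
      simp only [Complex.ofReal_one, one_mul] at this
      exact this.mono_left nhdsWithin_le_nhds
  have hR : Tendsto (fun r : ℝ => ∫ t in Ioo (0 : ℝ) 1,
      ((t ^ (p - 1) : ℝ) : ℂ) * (1 + r * -(t : ℂ)) ^ (s : ℂ)) (𝓝[<] 1)
      (𝓝 (∫ t in Ioo (0 : ℝ) 1, ((t ^ (p - 1) * (1 - t) ^ (s + 1 - 1) : ℝ) : ℂ))) := by
    have hb1 : IntegrableOn (fun t : ℝ => t ^ (p - 1) * (1 - t) ^ (s + 1 - 1)) (Ioo 0 1) :=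
      integrableOn_beta hp (by linarith)
    have hb2 : IntegrableOn (fun t : ℝ => t ^ (p - 1) * 2 ^ s) (Ioo 0 1) := by
      simpa [IntegrableOn] using (integrableOn_beta hp one_pos).mul_const (2 ^ s)
    refine tendsto_integral_filter_of_dominated_convergence
      (fun t => t ^ (p - 1) * 2 ^ s + t ^ (p - 1) * (1 - t) ^ (s + 1 - 1))
      (.of_forall fun r => by fun_prop) ?_ (hb2.add hb1) ?_
    · filter_upwards [hnear] with r hr
      filter_upwards [ae_restrict_mem measurableSet_Ioo] with t ht
      have hrt : r * t ≤ t := mul_le_of_le_one_left ht.1.le hr.2.le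
      have hrt0 : 0 < r * t := mul_pos hr.1 ht.1
      have ht' : 0 ≤ t ^ (p - 1) := rpow_nonneg ht.1.le _
      have h1 : 0 < 1 - t := by linarith [ht.2]
      rw [norm_mul, Complex.norm_real, norm_of_nonneg ht', Complex.norm_cpow_real, ← mul_add,
        show (1 + r * -(t : ℂ)) = ((1 - r * t : ℝ) : ℂ) by push_cast; ring, Complex.norm_real,
        norm_of_nonneg (by linarith : 0 ≤ 1 - r * t), add_sub_cancel_right]
      gcongr
      exact rpow_le_two_rpow_add_rpow h1 (by linarith) (by linarith)
    · filter_upwards [ae_restrict_mem measurableSet_Ioo] with t ht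
      have h1 : 0 < 1 - t := by linarith [ht.2]
      have hslit : 1 + ((1 : ℝ) : ℂ) * -(t : ℂ) ∈ Complex.slitPlane := by
        left
        simpa using ht.2
      have hcont : ContinuousAt (fun r : ℝ => ((t ^ (p - 1) : ℝ) : ℂ) *
          (1 + r * -(t : ℂ)) ^ (s : ℂ)) 1 :=
        continuousAt_const.mul (ContinuousAt.cpow (by fun_prop) continuousAt_const hslit)
      have h := hcont.tendsto.mono_left (nhdsWithin_le_nhds (s := Iio 1))
      convert h using 2
      rw [add_sub_cancel_right, Complex.ofReal_mul, Complex.ofReal_cpow h1.le]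
      push_cast
      ring_nf
  have heq := hL.congr' (hnear.mono fun r hr => integral_one_add_mul_exp_cpow hp s hr.1.le hr.2)
  rw [tendsto_nhds_unique heq (hR.const_mul _), integral_complex_ofReal,
    integral_beta hp (by linarith), ← Complex.ofReal_mul]

/-- The **Cauchy integral** `∫ cosˢ x · cos ((s + 2 p) x + δ)` over `(-π / 2, π / 2)`. -/
theorem integral_cos_rpow_mul_cos {p s : ℝ} (hp : 0 < p) (hs : -1 < s) (δ : ℝ) :
    ∫ x in Ioo (-(π / 2)) (π / 2), cos x ^ s * cos ((s + 2 * p) * x + δ) =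
      cos δ * sin (π * p) * (Gamma p * Gamma (s + 1) / Gamma (p + (s + 1))) / 2 ^ s := by
  obtain ⟨hint, hval⟩ := integral_exp_mul_one_add_exp_cpow hp hs
  have h := integral_re (hint.mul_const (Complex.exp (δ * Complex.I)))
  rw [integral_mul_const, hval] at h
  have e : ∀ x ∈ Ioo (-(π / 2)) (π / 2), RCLike.re (Complex.exp (2 * p * x * Complex.I) *
      (1 + Complex.exp (2 * x * Complex.I)) ^ (s : ℂ) * Complex.exp (δ * Complex.I)) =
      2 ^ s * (cos x ^ s * cos ((s + 2 * p) * x + δ)) := fun x hx => by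
    have : Complex.exp (2 * p * x * Complex.I) * (1 + Complex.exp (2 * x * Complex.I)) ^ (s : ℂ) *
        Complex.exp (δ * Complex.I) =
        (((2 * cos x) ^ s : ℝ) : ℂ) * Complex.exp ((((s + 2 * p) * x + δ : ℝ) : ℂ) * Complex.I) := by
      rw [one_add_exp_cpow s hx, mul_left_comm, mul_assoc, mul_assoc, ← Complex.exp_add,
        ← Complex.exp_add]
      push_cast
      ring_nf
    rw [this, mul_rpow two_pos.le (cos_pos_of_mem_Ioo hx).le]
    change Complex.re _ = _
    rw [Complex.re_ofReal_mul, Complex.exp_ofReal_mul_I_re, mul_assoc]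
  rw [setIntegral_congr_fun measurableSet_Ioo e, integral_const_mul] at h
  have hre : RCLike.re (((sin (π * p) * (Gamma p * Gamma (s + 1) / Gamma (p + (s + 1))) : ℝ) : ℂ) *
      Complex.exp (δ * Complex.I)) =
      sin (π * p) * (Gamma p * Gamma (s + 1) / Gamma (p + (s + 1))) * cos δ := by
    change Complex.re _ = _
    rw [Complex.re_ofReal_mul, Complex.exp_ofReal_mul_I_re]
  rw [hre] at h
  rw [eq_div_iff (by positivity)]
  linear_combination h

theorem Gamma_add_nat {x : ℝ} (hx : 0 < x) (k : ℕ) :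
    Gamma (x + k) = (ascPochhammer ℝ k).eval x * Gamma x := by
  induction k with
  | zero => simp
  | succ k ih =>
    rw [Nat.cast_succ, ← add_assoc, Gamma_add_one (by positivity), ih, ascPochhammer_succ_eval]
    ring

/-- Coefficients of `₂F₁((1 + m) / 2, (1 - m) / 2; 1 / 2 | x)` with `m = 6 a - 2`. -/
theorem pochhammer_coeff_recurrence (a : ℝ) (k : ℕ) :
    (2 * k + 1) * (2 * k + 2) *
      ((ascPochhammer ℝ (k + 1)).eval (3 * a - 1 / 2) *
        (ascPochhammer ℝ (k + 1)).eval (3 / 2 - 3 * a) /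
        ((ascPochhammer ℝ (k + 1)).eval (1 / 2 : ℝ) * (Nat.factorial (k + 1) : ℝ))) =
      ((2 * k + 1) ^ 2 - (6 * a - 2) ^ 2) *
      ((ascPochhammer ℝ k).eval (3 * a - 1 / 2) * (ascPochhammer ℝ k).eval (3 / 2 - 3 * a) /
        ((ascPochhammer ℝ k).eval (1 / 2 : ℝ) * (Nat.factorial k : ℝ))) := by
  have h1 : (ascPochhammer ℝ k).eval (1 / 2 : ℝ) ≠ 0 := (ascPochhammer_pos k _ (by norm_num)).ne'
  have h2 : (Nat.factorial k : ℝ) ≠ 0 := by positivity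
  have h3 : (1 / 2 : ℝ) + k ≠ 0 := by positivity
  simp only [ascPochhammer_succ_eval, Nat.factorial_succ, Nat.cast_mul, Nat.cast_succ]
  field_simp
  ring

theorem strictMonoOn_four_thirds_mul_sin_sq :
    StrictMonoOn (fun φ : ℝ => 4 / 3 * sin (φ / 3) ^ 2) (Icc 0 π) := by
  intro x hx y hy hxy
  have hπ := pi_pos
  have h1 : 0 ≤ sin (x / 3) :=
    sin_nonneg_of_nonneg_of_le_pi (by linarith [hx.1]) (by linarith [hx.2])
  have h2 : sin (x / 3) < sin (y / 3) :=
    sin_lt_sin_of_lt_of_le_pi_div_two (by linarith [hx.1]) (by linarith [hy.2]) (by linarith)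
  simp only
  gcongr

theorem image_four_thirds_mul_sin_sq :
    (fun φ : ℝ => 4 / 3 * sin (φ / 3) ^ 2) '' Ioo 0 π = Ioo 0 1 := by
  have hπ := pi_pos
  have e0 : 4 / 3 * sin (0 / 3 : ℝ) ^ 2 = 0 := by simp
  have e1 : 4 / 3 * sin (π / 3) ^ 2 = 1 := by
    rw [sin_pi_div_three, div_pow, sq_sqrt (by norm_num)]
    norm_num
  refine Subset.antisymm ?_ ?_
  · rintro _ ⟨φ, hφ, rfl⟩
    have l := strictMonoOn_four_thirds_mul_sin_sq ⟨le_rfl, hπ.le⟩ ⟨hφ.1.le, hφ.2.le⟩ hφ.1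
    have u := strictMonoOn_four_thirds_mul_sin_sq ⟨hφ.1.le, hφ.2.le⟩ ⟨hπ.le, le_rfl⟩ hφ.2
    simp only [e0, e1] at l u
    exact ⟨l, u⟩
  · have := intermediate_value_Ioo hπ.le
      (by fun_prop : ContinuousOn (fun φ : ℝ => 4 / 3 * sin (φ / 3) ^ 2) (Icc 0 π))
    simpa only [e0, e1] using this

theorem jacobian_mul_beta_weight (a : ℝ) {φ : ℝ} (hφ : φ ∈ Ioo 0 π) :
    8 / 9 * sin (φ / 3) * ((4 / 3 * sin (φ / 3) ^ 2) ^ (a - 1) *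
      (1 - 4 / 3 * sin (φ / 3) ^ 2) ^ (2 * a - 1)) =
    8 / 9 * (4 / 3) ^ (a - 1) / 3 ^ (2 * a - 1) * sin φ ^ (2 * a - 1) := by
  have hS : 0 < sin (φ / 3) :=
    sin_pos_of_pos_of_lt_pi (by linarith [hφ.1]) (by linarith [hφ.1, hφ.2])
  have hsin : 0 < sin φ := sin_pos_of_pos_of_lt_pi hφ.1 hφ.2
  have h3 : 1 - 4 / 3 * sin (φ / 3) ^ 2 = sin φ / (3 * sin (φ / 3)) := by
    have := sin_three_mul (φ / 3)
    rw [mul_div_cancel₀ _ (by norm_num)] at this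
    rw [this]
    field_simp
  have h4 : (sin (φ / 3) ^ 2) ^ (a - 1) * sin (φ / 3) = sin (φ / 3) ^ (2 * a - 1) := by
    rw [← rpow_natCast, ← rpow_mul hS.le, ← rpow_add_one hS.ne']
    congr 1
    push_cast
    ring
  have h5 : sin (φ / 3) ^ (2 * a - 1) ≠ 0 := (rpow_pos_of_pos hS _).ne'
  rw [h3, mul_rpow (by norm_num) (by positivity), div_rpow hsin.le (by positivity),
    mul_rpow (by norm_num) hS.le, ← h4]
  rw [← h4] at h5
  field_simp

theorem integral_sin_rpow_mul_cos {a : ℝ} (ha : 0 < a) :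
    ∫ φ in Ioo 0 π, sin φ ^ (2 * a - 1) * cos ((2 * a - 2 / 3) * φ) =
      sin (π * a + π / 6) * (1 / 2) * (Gamma (1 / 6) * Gamma (2 * a) / Gamma (2 * a + 1 / 6)) /
        2 ^ (2 * a - 1) := by
  have hπ := pi_pos
  have h := integral_cos_rpow_mul_cos (p := 1 / 6) (s := 2 * a - 1) (by norm_num) (by linarith)
    ((2 * a - 2 / 3) * (π / 2))
  have hshift := intervalIntegral.integral_comp_add_right (a := -(π / 2)) (b := π / 2)
    (fun φ => sin φ ^ (2 * a - 1) * cos ((2 * a - 2 / 3) * φ)) (π / 2)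
  rw [neg_add_cancel, add_halves, intervalIntegral.integral_of_le (by linarith),
    intervalIntegral.integral_of_le hπ.le, integral_Ioc_eq_integral_Ioo,
    integral_Ioc_eq_integral_Ioo] at hshift
  have hδ : cos ((2 * a - 2 / 3) * (π / 2)) = sin (π * a + π / 6) := by
    rw [← cos_pi_div_two_sub, ← cos_neg]
    ring_nf
  rw [hδ, show π * (1 / 6) = π / 6 by ring, sin_pi_div_six, sub_add_cancel,
    add_comm (1 / 6) (2 * a)] at h
  rw [← hshift, ← h]
  refine setIntegral_congr_fun measurableSet_Ioo fun x _ => ?_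
  simp only [sin_add_pi_div_two]
  ring_nf

theorem two_three_rpow_identity (a : ℝ) :
    8 / 9 * (4 / 3 : ℝ) ^ (a - 1) / 3 ^ (2 * a - 1) * (1 / 2 / 2 ^ (2 * a - 1)) *
      3 ^ (3 * a - 1 / 2) = 2 / √3 := by
  have h2 : (4 / 3 : ℝ) ^ (a - 1) = 2 ^ (2 * a - 1) / 2 / 3 ^ (a - 1) := by
    rw [div_rpow (by norm_num) (by norm_num), show (4 : ℝ) = 2 ^ (2 : ℝ) by norm_num,
      ← rpow_mul (by norm_num), show 2 * (a - 1) = 2 * a - 1 - 1 by ring,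
      rpow_sub_one (by norm_num)]
  have h3 : (3 : ℝ) ^ (3 * a - 1 / 2) = 3 ^ (2 * a - 1) * 3 ^ (a - 1) * 9 / √3 := by
    rw [show 3 * a - 1 / 2 = (2 * a - 1) + (a - 1) + 2 - 1 / 2 by ring, rpow_sub (by norm_num),
      rpow_add (by norm_num), rpow_add (by norm_num), sqrt_eq_rpow]
    norm_num
  rw [h2, h3]
  have : (0 : ℝ) < 2 ^ (2 * a - 1) := by positivity
  have : (0 : ℝ) < 3 ^ (2 * a - 1) := by positivity
  have : (0 : ℝ) < 3 ^ (a - 1) := by positivity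
  field_simp
  norm_num

theorem hypergeometric_3F2_special_value_a (a : ℝ) (ha : 1 / 6 ≤ a) :
    ∑' k : ℕ, (ascPochhammer ℝ k).eval a * (ascPochhammer ℝ k).eval (3 * a - 1 / 2) *
        (ascPochhammer ℝ k).eval (3 / 2 - 3 * a) /
        ((ascPochhammer ℝ k).eval (3 * a) * (ascPochhammer ℝ k).eval (1 / 2 : ℝ) *
          (Nat.factorial k : ℝ)) * (3 / 4 : ℝ) ^ k
      = Real.Gamma (1 / 6) * Real.Gamma (a + 1 / 3) * Real.Gamma (a + 2 / 3) /
          (π * Real.sqrt 3 * Real.Gamma (2 * a + 1 / 6)) * Real.sin (π * a + π / 6) := by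
  have hπ := pi_pos
  have ha0 : 0 < a := by linarith
  set f : ℕ → ℝ := fun k => (ascPochhammer ℝ k).eval (3 * a - 1 / 2) *
    (ascPochhammer ℝ k).eval (3 / 2 - 3 * a) /
    ((ascPochhammer ℝ k).eval (1 / 2 : ℝ) * (Nat.factorial k : ℝ)) with hf
  have hcos : ∀ {θ : ℝ}, θ ∈ Ioo (-(π / 2)) (π / 2) →
      HasSum (fun k => f k * (sin θ ^ 2) ^ k) (cos ((6 * a - 2) * θ) / cos θ) :=
    hasSum_cos_mul_div_cos (by simp [hf]) (pochhammer_coeff_recurrence a)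
  have hsum : Summable fun k => ‖f k * (3 / 4) ^ k‖ := by
    have := (hcos (θ := π / 3) ⟨by linarith, by linarith⟩).summable
    rw [sin_pi_div_three, div_pow, sq_sqrt (by norm_num)] at this
    norm_num at this
    exact this.norm
  have hS := hasSum_mul_integral_mul_pow (μ := volume.restrict (Ioo (0 : ℝ) 1))
    (w := fun t : ℝ => t ^ (a - 1) * (1 - t) ^ (2 * a - 1)) (z := fun t : ℝ => t)
    (g := fun t : ℝ => ∑' k, f k * (3 / 4) ^ k * t ^ k) (c := fun k => f k * (3 / 4) ^ k)
    (integrableOn_beta ha0 (by linarith)) (by fun_prop)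
    (by
      filter_upwards [ae_restrict_mem measurableSet_Ioo] with t ht
      simpa [abs_of_pos ht.1] using ht.2.le)
    hsum
    (by
      filter_upwards [ae_restrict_mem measurableSet_Ioo] with t ht
      refine Summable.hasSum (.of_norm_bounded hsum fun k => ?_)
      rw [norm_mul]
      refine mul_le_of_le_one_right (norm_nonneg _) ?_
      simpa [abs_of_pos ht.1] using pow_le_one₀ ht.1.le ht.2.le)
  have hGa := Gamma_pos_of_pos ha0
  have hG2a := Gamma_pos_of_pos (show 0 < 2 * a by positivity)
  have hG3a := Gamma_pos_of_pos (show 0 < 3 * a by positivity)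
  have hbeta : ∀ k : ℕ, ∫ t in Ioo (0 : ℝ) 1, t ^ (a - 1) * (1 - t) ^ (2 * a - 1) * t ^ k =
      (ascPochhammer ℝ k).eval a / (ascPochhammer ℝ k).eval (3 * a) *
        (Gamma a * Gamma (2 * a) / Gamma (3 * a)) := fun k => by
    have h := integral_beta (u := a + k) (v := 2 * a) (by positivity) (by positivity)
    rw [show a + k + 2 * a = 3 * a + k by ring, Gamma_add_nat ha0, Gamma_add_nat (by positivity)]
      at h
    have hp := ascPochhammer_pos k (3 * a) (by positivity)
    rw [setIntegral_congr_fun (g := fun t : ℝ => t ^ (a + k - 1) * (1 - t) ^ (2 * a - 1))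
      measurableSet_Ioo fun t ht => ?_, h]
    · field_simp
    · simp only [show a + k - 1 = a - 1 + k by ring, rpow_add_natCast ht.1.ne']
      ring
  have hint : ∫ t in Ioo (0 : ℝ) 1, t ^ (a - 1) * (1 - t) ^ (2 * a - 1) *
      ∑' k, f k * (3 / 4) ^ k * t ^ k =
      8 / 9 * (4 / 3) ^ (a - 1) / 3 ^ (2 * a - 1) *
        ∫ φ in Ioo 0 π, sin φ ^ (2 * a - 1) * cos ((2 * a - 2 / 3) * φ) := by
    have hderiv : ∀ φ ∈ Ioo 0 π, HasDerivWithinAt (fun φ : ℝ => 4 / 3 * sin (φ / 3) ^ 2)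
        (8 / 9 * sin (φ / 3) * cos (φ / 3)) (Ioo 0 π) φ := fun φ _ => by
      have h := ((((hasDerivAt_id φ).div_const 3).sin).fun_pow 2).const_mul (4 / 3)
      refine (h.congr_deriv ?_).hasDerivWithinAt
      simp only [id]
      push_cast
      ring
    rw [← image_four_thirds_mul_sin_sq, integral_image_eq_integral_abs_deriv_smul measurableSet_Ioo
      hderiv (strictMonoOn_four_thirds_mul_sin_sq.mono Ioo_subset_Icc_self).injOn,
      ← integral_const_mul]
    refine setIntegral_congr_fun measurableSet_Ioo fun φ hφ => ?_
    have hmem : φ / 3 ∈ Ioo (-(π / 2)) (π / 2) := ⟨by linarith [hφ.1], by linarith [hφ.2]⟩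
    have hsin : 0 < sin (φ / 3) :=
      sin_pos_of_pos_of_lt_pi (by linarith [hφ.1]) (by linarith [hφ.1, hφ.2])
    have hc := cos_pos_of_mem_Ioo hmem
    have hval : ∑' k, f k * (3 / 4) ^ k * (4 / 3 * sin (φ / 3) ^ 2) ^ k =
        cos ((2 * a - 2 / 3) * φ) / cos (φ / 3) := by
      rw [show (2 * a - 2 / 3) * φ = (6 * a - 2) * (φ / 3) by ring, ← (hcos hmem).tsum_eq]
      refine tsum_congr fun k => ?_
      rw [mul_assoc, ← mul_pow]
      ring_nf
    simp only [smul_eq_mul]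
    rw [hval, abs_of_pos (by positivity),
      ← mul_assoc (8 / 9 * (4 / 3 : ℝ) ^ (a - 1) / 3 ^ (2 * a - 1)), ← jacobian_mul_beta_weight a hφ]
    field_simp
  simp only [hbeta] at hS
  rw [hint, integral_sin_rpow_mul_cos ha0] at hS
  refine ((hS.div_const (Gamma a * Gamma (2 * a) / Gamma (3 * a))).congr_fun
    fun k => ?_).tsum_eq.trans ?_
  · have := (ascPochhammer_pos k (3 * a) (by positivity)).ne'
    simp only [hf]
    field_simp
  · have hG6 := Gamma_pos_of_pos (show 0 < 2 * a + 1 / 6 by positivity)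
    have key := two_three_rpow_identity a
    have h3 := Gamma_three_mul ha0
    have e : 8 / 9 * (4 / 3) ^ (a - 1) / 3 ^ (2 * a - 1) *
        (sin (π * a + π / 6) * (1 / 2) *
          (Gamma (1 / 6) * Gamma (2 * a) / Gamma (2 * a + 1 / 6)) / 2 ^ (2 * a - 1)) /
        (Gamma a * Gamma (2 * a) / Gamma (3 * a)) =
        8 / 9 * (4 / 3) ^ (a - 1) / 3 ^ (2 * a - 1) * (1 / 2 / 2 ^ (2 * a - 1)) *
        (sin (π * a + π / 6) * Gamma (1 / 6) * Gamma (3 * a) /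
          (Gamma a * Gamma (2 * a + 1 / 6))) := by
      field_simp
    rw [e, h3]
    calc _ = (8 / 9 * (4 / 3) ^ (a - 1) / 3 ^ (2 * a - 1) * (1 / 2 / 2 ^ (2 * a - 1)) *
          3 ^ (3 * a - 1 / 2)) * (sin (π * a + π / 6) * Gamma (1 / 6) *
          (Gamma (a + 1 / 3) * Gamma (a + 2 / 3)) / (2 * π * Gamma (2 * a + 1 / 6))) := by
          field_simp
      _ = _ := by
          rw [key]
          field_simp
end
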